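/- arXiv:2103.17216 — 3 statements merged into one kernel-verified Lean document; each statement's English description precedes it below -/
import Mathlib

section
/- Let n ≥ 5 and let t ≤ n be a prime. Then the alternating group Alt_n can be generated by a Sylow 2-subgroup together with a Sylow t-subgroup; that is, there exist a Sylow 2-subgroup P and a Sylow t-subgroup T of Alt_n with ⟨P, T⟩ = Alt_n. -/
/-- A subgroup `H` of `G` is intravariant if every automorphism of `G` maps `H`
to a conjugate of `H`. -/
def IsIntravariant {G : Type*} [Group G] (H : Subgroup G) : Prop :=
  ∀ a : MulAut G, ∃ g : G,
    H.map a.toMonoidHom = H.map (MulAut.conj g).toMonoidHom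

/-- A group is a `π`-group if every prime dividing its order lies in `π`. -/
def IsPiGroup (π : Set ℕ) (H : Type*) [Group H] : Prop :=
  ∀ p : ℕ, p.Prime → p ∣ Nat.card H → p ∈ π

open Equiv Equiv.Perm

section ThreeCycleLinked

variable {α : Type*} [DecidableEq α]

/-- Two points are linked by `H` if they are equal or consecutive in some 3-cycle of `H`. -/
def ThreeCycleLinked (H : Subgroup (Perm α)) (a b : α) : Prop :=
  a = b ∨ ∃ x, a ≠ b ∧ a ≠ x ∧ b ≠ x ∧ swap a b * swap b x ∈ H

namespace ThreeCycleLinked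

variable {H : Subgroup (Perm α)} {a b c : α}

theorem rotate_eq {x : α} (hab : a ≠ b) (hax : a ≠ x) (hbx : b ≠ x) :
    swap a b * swap b x = swap b x * swap x a := by
  ext y
  simp only [Perm.mul_apply, swap_apply_def]
  split_ifs <;> simp_all

theorem inv_eq {x : α} (hab : a ≠ b) (hax : a ≠ x) (hbx : b ≠ x) :
    (swap a b * swap b x)⁻¹ = swap b a * swap a x := by
  rw [mul_inv_rev, swap_inv, swap_inv]
  ext y
  simp only [Perm.mul_apply, swap_apply_def]
  split_ifs <;> simp_all

theorem refl (a : α) : ThreeCycleLinked H a a := Or.inl rfl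

theorem symm (h : ThreeCycleLinked H a b) : ThreeCycleLinked H b a := by
  obtain rfl | ⟨x, hab, hax, hbx, hx⟩ := h
  · exact refl _
  · refine Or.inr ⟨x, hab.symm, hbx, hax, ?_⟩
    rw [← inv_eq hab hax hbx]
    exact H.inv_mem hx

theorem map {σ : Perm α} (hσ : σ ∈ H) (h : ThreeCycleLinked H a b) :
    ThreeCycleLinked H (σ a) (σ b) := by
  obtain rfl | ⟨x, hab, hax, hbx, hx⟩ := h
  · exact refl _
  · refine Or.inr ⟨σ x, by simpa, by simpa, by simpa, ?_⟩
    have : swap (σ a) (σ b) * swap (σ b) (σ x) = σ * (swap a b * swap b x) * σ⁻¹ := by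
      rw [swap_apply_apply, swap_apply_apply]
      group
    rw [this]
    exact H.mul_mem (H.mul_mem hσ hx) (H.inv_mem hσ)

theorem trans (h : ThreeCycleLinked H a b) (h' : ThreeCycleLinked H b c) :
    ThreeCycleLinked H a c := by
  by_cases hab : a = b
  · rwa [hab]
  by_cases hac : a = c
  · rw [hac]; exact refl _
  obtain rfl | ⟨y, hbc, hby, hcy, hy⟩ := h'
  · exact h
  by_cases hay : a = y
  · subst hay
    refine symm (Or.inr ⟨b, Ne.symm hac, hbc.symm, hab, ?_⟩)
    rwa [← rotate_eq hbc hby hcy]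
  · have := map hy h
    rwa [Perm.mul_apply, Perm.mul_apply, swap_apply_of_ne_of_ne hac hay,
      swap_apply_of_ne_of_ne hab hac, swap_apply_of_ne_of_ne hbc hby, swap_apply_left] at this

end ThreeCycleLinked

open ThreeCycleLinked

theorem swap_mul_swap_linked {H : Subgroup (Perm α)} {a b x : α}
    (hab : a ≠ b) (hax : a ≠ x) (hbx : b ≠ x) (h : swap a b * swap b x ∈ H) :
    ThreeCycleLinked H a b ∧ ThreeCycleLinked H b x :=
  ⟨Or.inr ⟨x, hab, hax, hbx, h⟩,
    Or.inr ⟨a, hbx, hab.symm, hax.symm, by rwa [← rotate_eq hab hax hbx]⟩⟩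

theorem alternatingGroup_le_of_threeCycleLinked [Fintype α] [Nontrivial α]
    {H : Subgroup (Perm α)} (h : ∀ a b, ThreeCycleLinked H a b) :
    alternatingGroup α ≤ H := by
  have hprim : MulAction.IsPreprimitive H α := by
    refine { exists_smul_eq := fun a b => ?_, isTrivialBlock_of_isBlock := fun {B} hB => ?_ }
    · obtain rfl | ⟨x, hab, hax, hbx, hx⟩ := h a b
      · exact ⟨1, one_smul _ _⟩
      · refine ⟨⟨_, hx⟩, ?_⟩
        change (swap a b * swap b x) a = b
        rw [Perm.mul_apply, swap_apply_of_ne_of_ne hab hax, swap_apply_left]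
    · rw [MulAction.IsTrivialBlock, or_iff_not_imp_right, ← ne_eq, Set.ne_univ_iff_exists_notMem]
      rintro ⟨c, hc⟩ a ha b hb
      by_contra hab
      obtain rfl | ⟨x, hac, hax, hcx, hx⟩ := h a c
      · exact hc ha
      have hca : (swap a c * swap c x) a = c := by
        rw [Perm.mul_apply, swap_apply_of_ne_of_ne hac hax, swap_apply_left]
      have hbB : (swap a c * swap c x) b ∈ B := by
        have hbc : b ≠ c := by rintro rfl; exact hc hb
        by_cases hbx : b = x
        · subst hbx
          simpa using ha
        · rwa [Perm.mul_apply, swap_apply_of_ne_of_ne hbc hbx,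
            swap_apply_of_ne_of_ne (Ne.symm hab) hbc]
      have hBB := MulAction.isBlock_iff_smul_eq_of_mem.1 hB
        (g := (⟨_, hx⟩ : H)) hb hbB
      refine hc ?_
      rw [← hBB]
      exact ⟨a, ha, hca⟩
  obtain ⟨a, b, hab⟩ := exists_pair_ne α
  obtain rfl | ⟨x, -, hax, hbx, hx⟩ := h a b
  · exact absurd rfl hab
  refine alternatingGroup_le_of_isPreprimitive_of_isThreeCycle_mem hprim ?_ hx
  rw [swap_comm a b]
  exact isThreeCycle_swap_mul_swap_same hab.symm hbx hax

/-- If `u` moves `x₃` to `x₂`, fixes `x₄` and commutes with `v`, then the commutator of `u` and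
`swap x₃ x₄ * v` is a 3-cycle on `x₂`, `x₃`, `x₄`. -/
theorem threeCycleLinked_of_commutator {H : Subgroup (Perm α)} {x₂ x₃ x₄ : α} {u v : Perm α}
    (h₂₃ : x₂ ≠ x₃) (h₂₄ : x₂ ≠ x₄) (h₃₄ : x₃ ≠ x₄)
    (hu₃ : u x₃ = x₂) (hu₄ : u x₄ = x₄) (huv : u * v = v * u)
    (hu : u ∈ H) (hw : swap x₃ x₄ * v ∈ H) :
    ThreeCycleLinked H x₂ x₃ ∧ ThreeCycleLinked H x₃ x₄ := by
  have key : u * (swap x₃ x₄ * v) * u⁻¹ * (swap x₃ x₄ * v)⁻¹ = swap x₂ x₄ * swap x₄ x₃ := by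
    have h1 : u * swap x₃ x₄ * u⁻¹ = swap x₂ x₄ := by
      rw [← swap_apply_apply, hu₃, hu₄]
    have h2 : u * v * u⁻¹ = v := by rw [huv, mul_inv_cancel_right]
    calc _ = (u * swap x₃ x₄ * u⁻¹) * (u * v * u⁻¹) * v⁻¹ * (swap x₃ x₄)⁻¹ := by group
      _ = _ := by rw [h1, h2, mul_inv_cancel_right, swap_inv, swap_comm x₃]
  have hmem : swap x₂ x₄ * swap x₄ x₃ ∈ H := by
    rw [← key]
    exact H.mul_mem (H.mul_mem (H.mul_mem hu hw) (H.inv_mem hu)) (H.inv_mem hw)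
  obtain ⟨h, h'⟩ := swap_mul_swap_linked h₂₄ h₂₃ h₃₄.symm hmem
  exact ⟨h.trans h', h'.symm⟩

end ThreeCycleLinked

section PGroup

variable {G : Type*} [Group G]

theorem isPGroup_closure_of_commute {p : ℕ} {C : Set G}
    (hcomm : ∀ x ∈ C, ∀ y ∈ C, x * y = y * x) (hpow : ∀ x ∈ C, x ^ p = 1) :
    IsPGroup p (Subgroup.closure C) := by
  have := Subgroup.isMulCommutative_closure hcomm
  rintro ⟨x, hx⟩
  refine ⟨1, Subtype.ext ?_⟩
  simp only [pow_one, Subgroup.coe_pow, Subgroup.coe_one]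
  induction hx using Subgroup.closure_induction with
  | mem x hx => exact hpow x hx
  | one => exact one_pow _
  | mul x y hx hy ihx ihy =>
    have hxy : Commute x y := setLike_mul_comm hx hy
    rw [hxy.mul_pow, ihx, ihy, one_mul]
  | inv x hx ih => rw [inv_pow, ih, inv_one]

theorem isPGroup_two_closure_sup_zpowers {C : Set G} {f : G}
    (hcomm : ∀ x ∈ C, ∀ y ∈ C, x * y = y * x) (hsq : ∀ x ∈ C, x ^ 2 = 1)
    (hf : f ^ 2 = 1) (hconj : ∀ x ∈ C, f * x * f⁻¹ ∈ C) :
    IsPGroup 2 (Subgroup.closure C ⊔ Subgroup.zpowers f : Subgroup G) := by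
  refine IsPGroup.to_sup_of_normal_left' (isPGroup_closure_of_commute hcomm hsq) ?_ ?_
  · rw [Subgroup.zpowers_eq_closure]
    exact isPGroup_closure_of_commute (by simp) (by simpa)
  · rw [Subgroup.zpowers_le]
    have hmap : (Subgroup.closure C).map (MulAut.conj f).toMonoidHom ≤ Subgroup.closure C := by
      rw [MonoidHom.map_closure, Subgroup.closure_le]
      rintro _ ⟨x, hx, rfl⟩
      exact Subgroup.subset_closure (hconj x hx)
    have hff : f⁻¹ = f := by rw [inv_eq_iff_mul_eq_one, ← sq, hf]
    have hmem : ∀ x ∈ Subgroup.closure C, f * x * f⁻¹ ∈ Subgroup.closure C :=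
      fun x hx => hmap ⟨x, hx, rfl⟩
    refine Subgroup.mem_normalizer_iff.2 fun x => ⟨hmem x, fun hx => ?_⟩
    have := hmem _ hx
    rw [hff] at this
    simpa only [mul_assoc, ← sq, hf, mul_one, ← mul_assoc f f x, one_mul] using this

end PGroup

/-- Reduction to subgroups of the symmetric group. -/
theorem exists_sylow_sup_eq_top {α : Type*} [Fintype α] [DecidableEq α] [Nontrivial α] {p q : ℕ}
    {S R : Subgroup (Perm α)} (hS : IsPGroup p S) (hR : IsPGroup q R)
    (h : ∀ a b, ThreeCycleLinked (S ⊓ alternatingGroup α ⊔ R ⊓ alternatingGroup α) a b) :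
    ∃ (P : Sylow p (alternatingGroup α)) (T : Sylow q (alternatingGroup α)),
      (P : Subgroup (alternatingGroup α)) ⊔ (T : Subgroup _) = ⊤ := by
  have hle := alternatingGroup_le_of_threeCycleLinked h
  obtain ⟨P, hP⟩ := (hS.comap_subtype (K := alternatingGroup α)).exists_le_sylow
  obtain ⟨T, hT⟩ := (hR.comap_subtype (K := alternatingGroup α)).exists_le_sylow
  refine ⟨P, T, top_le_iff.1 (le_trans ?_ (sup_le_sup hP hT))⟩
  rw [← Subgroup.map_subtype_le_map_subtype, Subgroup.map_sup]
  simpa [Subgroup.map_comap_eq, inf_comm, ← MonoidHom.range_eq_map] using hle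

theorem swap_commute {α : Type*} [DecidableEq α] {a b c d : α}
    (h : (a = c ∧ b = d) ∨ (a = d ∧ b = c) ∨ (a ≠ c ∧ a ≠ d ∧ b ≠ c ∧ b ≠ d)) :
    Commute (swap a b) (swap c d) := by
  obtain ⟨rfl, rfl⟩ | ⟨rfl, rfl⟩ | ⟨hac, had, hbc, hbd⟩ := h
  · rfl
  · rw [swap_comm]
  · refine Disjoint.commute fun x => ?_
    by_cases hx : x = a ∨ x = b
    · right; rcases hx with rfl | rfl
      · exact swap_apply_of_ne_of_ne hac had
      · exact swap_apply_of_ne_of_ne hbc hbd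
    · left
      push Not at hx
      exact swap_apply_of_ne_of_ne hx.1 hx.2

section CyclicShift

variable {α : Type*} [DecidableEq α] {H : Subgroup (Perm α)}

theorem threeCycleLinked_pow {c : Perm α} (hc : c ∈ H) {a : α} {i : ℕ}
    (h : ThreeCycleLinked H ((c ^ i) a) ((c ^ (i + 1)) a)) (k : ℕ) :
    ThreeCycleLinked H a ((c ^ k) a) := by
  have h1 : ThreeCycleLinked H a (c a) := by
    have := h.map (H.inv_mem (H.pow_mem hc i))
    rwa [pow_succ, Perm.mul_apply, Perm.inv_eq_iff_eq.2 rfl, Perm.inv_eq_iff_eq.2 rfl] at this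
  induction k with
  | zero => exact ThreeCycleLinked.refl _
  | succ k ih =>
    refine ih.trans ?_
    rw [pow_succ, Perm.mul_apply]
    exact h1.map (H.pow_mem hc k)

/-- A double transposition of four consecutive points of a `t`-cycle generates, together with
the cycle, a 3-cycle. -/
theorem threeCycleLinked_of_double_swap {c : Perm α} (hc : c ∈ H) {a : α} {t : ℕ}
    (ht : t = 5 ∨ 7 ≤ t) (hct : (c ^ t) a = a)
    (hinj : ∀ i j, i < t → j < t → i ≠ j → (c ^ i) a ≠ (c ^ j) a)
    (hswap : swap a (c a) * swap ((c ^ 2) a) ((c ^ 3) a) ∈ H) (k : ℕ) :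
    ThreeCycleLinked H a ((c ^ k) a) := by
  have hne : ∀ i j, i < t → j < t → i ≠ j → (c ^ i) a ≠ (c ^ j) a := hinj
  have h3 : swap ((c ^ 3) a) ((c ^ 4) a) * swap ((c ^ 5) a) ((c ^ 6) a) ∈ H := by
    have : swap ((c ^ 3) a) ((c ^ 4) a) * swap ((c ^ 5) a) ((c ^ 6) a) =
        c ^ 3 * (swap a (c a) * swap ((c ^ 2) a) ((c ^ 3) a)) * (c ^ 3)⁻¹ := by
      rw [show (c ^ 4) a = (c ^ 3) (c a) from rfl, show (c ^ 5) a = (c ^ 3) ((c ^ 2) a) from rfl,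
        show (c ^ 6) a = (c ^ 3) ((c ^ 3) a) from rfl, swap_apply_apply, swap_apply_apply]
      group
    rw [this]
    exact H.mul_mem (H.mul_mem (H.pow_mem hc 3) hswap) (H.inv_mem (H.pow_mem hc 3))
  have h0 : a = (c ^ 0) a := rfl
  have h1 : c a = (c ^ 1) a := rfl
  rw [h1] at hswap
  nth_rw 1 [h0] at hswap
  refine threeCycleLinked_pow hc (i := 2) (threeCycleLinked_of_commutator
    (hne 2 3 (by omega) (by omega) (by omega)) (hne 2 4 (by omega) (by omega) (by omega))
    (hne 3 4 (by omega) (by omega) (by omega)) ?_ ?_ ?_ hswap h3).1 k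
  · rw [Perm.mul_apply, swap_apply_right, swap_apply_of_ne_of_ne]
    · exact hne 2 0 (by omega) (by omega) (by omega)
    · exact hne 2 1 (by omega) (by omega) (by omega)
  · rw [Perm.mul_apply, swap_apply_of_ne_of_ne (hne 4 2 (by omega) (by omega) (by omega))
      (hne 4 3 (by omega) (by omega) (by omega)), swap_apply_of_ne_of_ne
      (hne 4 0 (by omega) (by omega) (by omega)) (hne 4 1 (by omega) (by omega) (by omega))]
  · have hd : ∀ i j k l, i < t → j < t → k < t → l < t → i ≠ k → i ≠ l → j ≠ k → j ≠ l →
        Commute (swap ((c ^ i) a) ((c ^ j) a)) (swap ((c ^ k) a) ((c ^ l) a)) := by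
      intro i j k l hi hj hk hl hik hil hjk hjl
      exact swap_commute (Or.inr (Or.inr ⟨hne _ _ hi hk hik, hne _ _ hi hl hil, hne _ _ hj hk hjk,
        hne _ _ hj hl hjl⟩))
    obtain rfl | ht := ht
    · have h6 : (c ^ 6) a = (c ^ 1) a := by
        rw [show (c ^ 6) a = (c ^ 1) ((c ^ 5) a) from rfl, hct]
      rw [h6, show (c ^ 5) a = (c ^ 0) a from hct]
      refine Commute.mul_left rfl (hd 2 3 0 1 ?_ ?_ ?_ ?_ ?_ ?_ ?_ ?_) <;> omega
    · refine Commute.mul_left (hd 0 1 5 6 ?_ ?_ ?_ ?_ ?_ ?_ ?_ ?_)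
        (hd 2 3 5 6 ?_ ?_ ?_ ?_ ?_ ?_ ?_ ?_) <;> omega

end CyclicShift

section SwapGroup

variable {n : ℕ}

/-- The group generated by the transpositions of `Fin n` prescribed by `L`, together with `f`. -/
def swapGroup (L : ℕ → ℕ → Prop) (f : Perm (Fin n)) : Subgroup (Perm (Fin n)) :=
  Subgroup.closure {σ | ∃ a b : Fin n, L a b ∧ σ = swap a b} ⊔ Subgroup.zpowers f

/-- Any two of the pairs prescribed by `L` are equal or disjoint. -/
def PairsDisjoint (L : ℕ → ℕ → Prop) : Prop :=
  ∀ a b c d, L a b → L c d →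
    (a = c ∧ b = d) ∨ (a = d ∧ b = c) ∨ (a ≠ c ∧ a ≠ d ∧ b ≠ c ∧ b ≠ d)

theorem isPGroup_swapGroup {L : ℕ → ℕ → Prop} (hL : PairsDisjoint L) {f : Perm (Fin n)}
    (hf : f ^ 2 = 1) (hLf : ∀ a b : Fin n, L a b → L (f a) (f b)) :
    IsPGroup 2 (swapGroup L f) := by
  refine isPGroup_two_closure_sup_zpowers ?_ ?_ hf ?_
  · rintro _ ⟨a, b, hab, rfl⟩ _ ⟨c, d, hcd, rfl⟩
    refine swap_commute ?_
    simpa only [ne_eq, Fin.ext_iff] using hL a b c d hab hcd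
  · rintro _ ⟨a, b, hab, rfl⟩
    rw [sq, swap_mul_self]
  · rintro _ ⟨a, b, hab, rfl⟩
    exact ⟨f a, f b, hLf a b hab, (swap_apply_apply f a b).symm⟩

theorem swap_mem_swapGroup {L : ℕ → ℕ → Prop} (f : Perm (Fin n)) {a b : Fin n}
    (h : L a b) : swap a b ∈ swapGroup L f :=
  Subgroup.mem_sup_left (Subgroup.subset_closure ⟨a, b, h, rfl⟩)

theorem mem_swapGroup (L : ℕ → ℕ → Prop) (f : Perm (Fin n)) : f ∈ swapGroup L f :=
  Subgroup.mem_sup_right (Subgroup.mem_zpowers f)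

theorem swap_mul_swap_mem_alternatingGroup {α : Type*} [Fintype α] [DecidableEq α] {a b c d : α}
    (hab : a ≠ b) (hcd : c ≠ d) : swap a b * swap c d ∈ alternatingGroup α := by
  simp [mem_alternatingGroup, sign_swap hab, sign_swap hcd]

end SwapGroup

section BlockCycle

theorem add_le_of_dvd_of_lt {t a b : ℕ} (ha : t ∣ a) (hb : t ∣ b) (hab : a < b) : a + t ≤ b := by
  obtain ⟨i, rfl⟩ := ha
  obtain ⟨j, rfl⟩ := hb
  rw [← Nat.mul_succ]
  exact Nat.mul_le_mul_left t (Nat.lt_of_mul_lt_mul_left hab)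

variable {n : ℕ}

/-- The embedding of `Fin t` into `Fin n` with image `[s, s + t)`. -/
def intervalEmb {s t : ℕ} (h : s + t ≤ n) : Fin t ↪ Fin n :=
  ⟨fun i => ⟨s + i, by omega⟩, fun i j hij => by simpa [Fin.ext_iff] using hij⟩

theorem intervalEmb_apply {s t : ℕ} (h : s + t ≤ n) (i : Fin t) :
    intervalEmb h i = ⟨s + i, by omega⟩ := rfl

theorem mem_range_intervalEmb {s t : ℕ} (h : s + t ≤ n) (x : Fin n) :
    x ∈ Set.range (intervalEmb h) ↔ s ≤ x ∧ (x : ℕ) < s + t := by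
  constructor
  · rintro ⟨i, rfl⟩
    simp [intervalEmb_apply]
  · rintro ⟨h1, h2⟩
    exact ⟨⟨x - s, by omega⟩, Fin.ext (by rw [intervalEmb_apply]; dsimp only; omega)⟩

/-- The cycle `(s, s + 1, …, s + t - 1)`. -/
noncomputable def intervalCycle {s t : ℕ} [NeZero t] (h : s + t ≤ n) : Perm (Fin n) :=
  viaEmbedding (Equiv.addRight (1 : Fin t)) (intervalEmb h)

variable {s t : ℕ} [NeZero t] (h : s + t ≤ n)

theorem addRight_one_pow (k : ℕ) (i : Fin t) :
    ((Equiv.addRight (1 : Fin t)) ^ k) i = i + Fin.ofNat t k := by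
  induction k with
  | zero => simp
  | succ k ih => rw [pow_succ', Perm.mul_apply, ih]; simp [Fin.ext_iff, Fin.val_add, add_assoc]

theorem intervalCycle_pow_eq (k : ℕ) :
    intervalCycle h ^ k = viaEmbedding (Equiv.addRight (1 : Fin t) ^ k) (intervalEmb h) := by
  rw [intervalCycle, ← viaEmbeddingHom_apply, ← viaEmbeddingHom_apply, map_pow]

theorem intervalCycle_pow_card : intervalCycle h ^ t = 1 := by
  rw [intervalCycle_pow_eq, show Equiv.addRight (1 : Fin t) ^ t = 1 from
    Equiv.ext fun i => by rw [addRight_one_pow]; simp, ← viaEmbeddingHom_apply, map_one]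

theorem intervalCycle_apply_of_notMem {x : Fin n} (hx : ¬ (s ≤ x ∧ (x : ℕ) < s + t)) :
    intervalCycle h x = x :=
  viaEmbedding_apply_of_notMem _ _ _ (by rwa [mem_range_intervalEmb])

theorem intervalCycle_pow_apply {k : ℕ} (hk : k < t) :
    (intervalCycle h ^ k) ⟨s, by omega⟩ = ⟨s + k, by omega⟩ := by
  have h0 : (⟨s, by omega⟩ : Fin n) = intervalEmb h 0 := by simp [intervalEmb_apply]
  rw [h0, intervalCycle_pow_eq, viaEmbedding_apply, addRight_one_pow]
  simp [intervalEmb_apply, Nat.mod_eq_of_lt hk]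

theorem intervalCycle_commute {s' : ℕ} (h' : s' + t ≤ n) (hs : s + t ≤ s' ∨ s' + t ≤ s) :
    Commute (intervalCycle h) (intervalCycle h') := by
  refine Disjoint.commute fun x => ?_
  by_cases hx : s ≤ x ∧ (x : ℕ) < s + t
  · exact Or.inr (intervalCycle_apply_of_notMem h' (by omega))
  · exact Or.inl (intervalCycle_apply_of_notMem h hx)

/-- The group generated by the `t`-cycles on the intervals `[s, s + t)` with `t ∣ s`. -/
def blockGroup (n t : ℕ) [NeZero t] : Subgroup (Perm (Fin n)) :=
  Subgroup.closure {c | ∃ (s : ℕ) (h : s + t ≤ n), t ∣ s ∧ c = intervalCycle h}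

theorem isPGroup_blockGroup (n t : ℕ) [NeZero t] : IsPGroup t (blockGroup n t) := by
  refine isPGroup_closure_of_commute ?_ ?_
  · rintro _ ⟨a, ha, hta, rfl⟩ _ ⟨b, hb, htb, rfl⟩
    obtain hab | rfl | hab := lt_trichotomy a b
    · exact intervalCycle_commute ha hb (Or.inl (add_le_of_dvd_of_lt hta htb hab))
    · rfl
    · exact intervalCycle_commute ha hb (Or.inr (add_le_of_dvd_of_lt htb hta hab))
  · rintro _ ⟨a, ha, -, rfl⟩
    exact intervalCycle_pow_card ha

theorem intervalCycle_mem (ht : Odd t) (hts : t ∣ s) :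
    intervalCycle h ∈ blockGroup n t ⊓ alternatingGroup (Fin n) := by
  refine Subgroup.mem_inf.2 ⟨Subgroup.subset_closure ⟨s, h, hts, rfl⟩, ?_⟩
  rw [mem_alternatingGroup]
  have := congrArg sign (intervalCycle_pow_card h)
  rw [map_pow, map_one] at this
  obtain h1 | h1 := Int.units_eq_one_or (sign (intervalCycle h))
  · exact h1
  · rw [h1, ht.neg_one_pow] at this
    exact absurd this (by decide)

end BlockCycle

section Linking

variable {n : ℕ} {H : Subgroup (Perm (Fin n))}

theorem threeCycleLinked_interval {s t : ℕ} [NeZero t] {h : s + t ≤ n} (hc : intervalCycle h ∈ H)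
    {i : ℕ} (hi : i + 1 < t)
    (hlink : ThreeCycleLinked H ⟨s + i, by omega⟩ ⟨s + (i + 1), by omega⟩) (k : ℕ) (hk : k < t) :
    ThreeCycleLinked H ⟨s, by omega⟩ ⟨s + k, by omega⟩ := by
  rw [← intervalCycle_pow_apply h hk]
  refine threeCycleLinked_pow hc (i := i) ?_ k
  rwa [intervalCycle_pow_apply h (by omega), intervalCycle_pow_apply h hi]

/-- A link from outside an interval into it extends to the whole interval. -/
theorem threeCycleLinked_interval_of_fixed {s t : ℕ} [NeZero t] {h : s + t ≤ n}
    (hc : intervalCycle h ∈ H) {z : Fin n} (hz : (z : ℕ) < s)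
    (hlink : ThreeCycleLinked H z ⟨s, by have := NeZero.pos t; omega⟩) (k : ℕ) (hk : k < t) :
    ThreeCycleLinked H z ⟨s + k, by omega⟩ := by
  rw [← intervalCycle_pow_apply h hk]
  have hfix : (intervalCycle h ^ k) z = z :=
    pow_apply_eq_self_of_apply_eq_self (intervalCycle_apply_of_notMem h (by omega)) k
  have := hlink.map (H.pow_mem hc k)
  rwa [hfix] at this

theorem threeCycleLinked_first_interval {t : ℕ} [NeZero t] (ht : t = 5 ∨ 7 ≤ t) (h : 0 + t ≤ n)
    (hc : intervalCycle h ∈ H)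
    (hswap : swap (⟨0, by omega⟩ : Fin n) ⟨1, by omega⟩ * swap ⟨2, by omega⟩ ⟨3, by omega⟩ ∈ H)
    (x : Fin n) (hx : (x : ℕ) < t) : ThreeCycleLinked H ⟨0, by omega⟩ x := by
  have hpow : ∀ k (hk : k < t), (intervalCycle h ^ k) ⟨0, by omega⟩ = ⟨k, by omega⟩ := by
    intro k hk
    rw [intervalCycle_pow_apply h hk]
    simp
  have key := threeCycleLinked_of_double_swap hc (a := ⟨0, by omega⟩) ht
    (by rw [intervalCycle_pow_card]; rfl) ?_ ?_ x
  · rwa [hpow _ hx] at key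
  · intro i j hi hj hij
    rw [hpow i hi, hpow j hj]
    simpa
  · rw [← pow_one (intervalCycle h), ← pow_mul, ← pow_mul, hpow _ (by omega), hpow _ (by omega),
      hpow _ (by omega)]
    exact hswap

theorem eq_swap_mul_swap {α : Type*} [DecidableEq α] {c : Perm α} {a b x : α} (hab : a ≠ b)
    (hax : a ≠ x) (ha : c a = b) (hb : c b = x) (hx : c x = a)
    (hfix : ∀ y, y ≠ a → y ≠ b → y ≠ x → c y = y) : c = swap a b * swap b x := by
  ext y
  simp only [Perm.mul_apply, swap_apply_def]
  split_ifs <;> simp_all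

theorem threeCycleLinked_first_interval_three (h : 0 + 3 ≤ n) (hc : intervalCycle h ∈ H)
    (x : Fin n) (hx : (x : ℕ) < 3) : ThreeCycleLinked H ⟨0, by omega⟩ x := by
  have hpow : ∀ k (hk : k < 3), (intervalCycle h ^ k) ⟨0, by omega⟩ = ⟨k, by omega⟩ := by
    intro k hk
    rw [intervalCycle_pow_apply h hk]
    simp
  have hceq : intervalCycle h = swap ⟨0, by omega⟩ ⟨1, by omega⟩ * swap ⟨1, by omega⟩
      ⟨2, by omega⟩ := by
    refine eq_swap_mul_swap (by simp) (by simp) ?_ ?_ ?_ ?_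
    · exact hpow 1 (by omega)
    · rw [← hpow 1 (by omega), ← hpow 2 (by omega)]; rfl
    · rw [← hpow 2 (by omega)]
      change (intervalCycle h ^ 3) _ = _
      rw [intervalCycle_pow_card]; rfl
    · intro y h0 h1 h2
      refine intervalCycle_apply_of_notMem h ?_
      simp only [ne_eq, Fin.ext_iff] at h0 h1 h2
      omega
  have hmem := hc
  rw [hceq] at hmem
  have := threeCycleLinked_interval hc (i := 0) (by omega)
    (by simpa using (swap_mul_swap_linked (by simp) (by simp) (by simp) hmem).1) x hx
  simpa using this

theorem threeCycleLinked_of_swap_mul_swap {α : Type*} [DecidableEq α] {H : Subgroup (Perm α)}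
    {o z a b : α} (ha : o ≠ a ∧ z ≠ a) (hb : o ≠ b ∧ z ≠ b) (hmem : swap o z * swap a b ∈ H)
    (hz : ThreeCycleLinked H o z) (hlink : ThreeCycleLinked H o a) : ThreeCycleLinked H o b := by
  have := (hz.symm.trans hlink).map hmem
  rwa [Perm.mul_apply, Perm.mul_apply, swap_apply_of_ne_of_ne ha.2 hb.2, swap_apply_right,
    swap_apply_left, swap_apply_of_ne_of_ne hb.1.symm hb.2.symm] at this

end Linking

section Construction

variable {n : ℕ}

theorem exists_sylow_of_swapGroup_of_blockGroup {t : ℕ} [NeZero t] (hn : 5 ≤ n)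
    {L : ℕ → ℕ → Prop} (hL : PairsDisjoint L) {f : Perm (Fin n)}
    (hf : f ^ 2 = 1) (hLf : ∀ a b : Fin n, L a b → L (f a) (f b))
    (hlink : ∀ x, ThreeCycleLinked (swapGroup L f ⊓ alternatingGroup (Fin n) ⊔
      blockGroup n t ⊓ alternatingGroup (Fin n)) ⟨0, by omega⟩ x) :
    ∃ (P : Sylow 2 (alternatingGroup (Fin n))) (T : Sylow t (alternatingGroup (Fin n))),
      (P : Subgroup (alternatingGroup (Fin n))) ⊔ (T : Subgroup _) = ⊤ := by
  have : Nontrivial (Fin n) := Fin.nontrivial_iff_two_le.2 (by omega)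
  exact exists_sylow_sup_eq_top (isPGroup_swapGroup hL hf hLf) (isPGroup_blockGroup n t)
    fun a b => (hlink a).symm.trans (hlink b)

/-- The case `t ≤ n < 2t`, with an involution `f` joining the points outside `[0, t)` to it. -/
theorem exists_sylow_of_involution {t : ℕ} [NeZero t] (ht : t = 5 ∨ 7 ≤ t) (hodd : Odd t)
    (htn : t ≤ n) {L : ℕ → ℕ → Prop} (hL : PairsDisjoint L) (hL₀ : L 0 1) (hL₂ : L 2 3)
    {f : Perm (Fin n)} (hf : f ^ 2 = 1) (hLf : ∀ a b : Fin n, L a b → L (f a) (f b))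
    (hout : ∀ y : Fin n, t ≤ y → (f y : ℕ) < t) (hin : ∃ p : Fin n, (p : ℕ) < t ∧ (f p : ℕ) < t) :
    ∃ (P : Sylow 2 (alternatingGroup (Fin n))) (T : Sylow t (alternatingGroup (Fin n))),
      (P : Subgroup (alternatingGroup (Fin n))) ⊔ (T : Subgroup _) = ⊤ := by
  refine exists_sylow_of_swapGroup_of_blockGroup (by omega) hL hf hLf ?_
  set H := swapGroup L f ⊓ alternatingGroup (Fin n) ⊔ blockGroup n t ⊓ alternatingGroup (Fin n)
  have hS : ∀ σ ∈ swapGroup L f, σ ∈ alternatingGroup (Fin n) → σ ∈ H := fun σ h1 h2 =>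
    Subgroup.mem_sup_left ⟨h1, h2⟩
  have h01 : swap (⟨0, by omega⟩ : Fin n) ⟨1, by omega⟩ ∈ swapGroup L f := swap_mem_swapGroup f hL₀
  have h23 : swap (⟨2, by omega⟩ : Fin n) ⟨3, by omega⟩ ∈ swapGroup L f := swap_mem_swapGroup f hL₂
  have hfirst := threeCycleLinked_first_interval ht (by omega) (H := H)
    (Subgroup.mem_sup_right (intervalCycle_mem (by omega) hodd (dvd_zero t)))
    (hS _ (mul_mem h01 h23) (swap_mul_swap_mem_alternatingGroup (by simp) (by simp)))
  have hff : ∀ y, f (f y) = y := fun y => by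
    rw [← Perm.mul_apply, ← sq, hf]; rfl
  -- an even element that acts on the first interval as `f` does, up to a permutation of it
  obtain ⟨τ, hτ, hτt, hτmem⟩ : ∃ τ : Perm (Fin n), (∀ x, τ (τ x) = x) ∧
      (∀ x : Fin n, (x : ℕ) < t → (τ x : ℕ) < t) ∧ f * τ ∈ H := by
    obtain h1 | h1 := Int.units_eq_one_or (sign f)
    · exact ⟨1, fun _ => rfl, fun _ h => h, hS _ (by simpa using mem_swapGroup L f) (by simpa)⟩
    · refine ⟨swap ⟨0, by omega⟩ ⟨1, by omega⟩,
        fun x => by rw [← Perm.mul_apply, swap_mul_self, one_apply], fun x hx => ?_,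
        hS _ (mul_mem (mem_swapGroup L f) h01) ?_⟩
      · rw [swap_apply_def]
        split_ifs <;> first | exact hx | (simp only; omega)
      · rw [mem_alternatingGroup, map_mul, h1, sign_swap (by simp)]
        decide
  obtain ⟨p, hp, hfp⟩ := hin
  intro x
  by_cases hx : (x : ℕ) < t
  · exact hfirst x hx
  · have hlink : ThreeCycleLinked H (τ p) (τ (f x)) :=
      (hfirst _ (hτt _ hp)).symm.trans (hfirst _ (hτt _ (hout x (by omega))))
    have := hlink.map hτmem
    rw [Perm.mul_apply, Perm.mul_apply, hτ, hτ, hff] at this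
    exact (hfirst _ hfp).trans this

theorem exists_sylow_of_lt_two_mul {t : ℕ} [NeZero t] (ht : t = 5 ∨ 7 ≤ t) (hodd : Odd t)
    (htn : t ≤ n) (hnt : n < 2 * t) :
    ∃ (P : Sylow 2 (alternatingGroup (Fin n))) (T : Sylow t (alternatingGroup (Fin n))),
      (P : Subgroup (alternatingGroup (Fin n))) ⊔ (T : Subgroup _) = ⊤ := by
  obtain rfl | htn := htn.eq_or_lt
  · refine exists_sylow_of_involution ht hodd le_rfl
      (L := fun a b => a = 0 ∧ b = 1 ∨ a = 2 ∧ b = 3) ?_ (by simp) (by simp) (f := 1) (one_pow 2)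
      (fun a b h => h) (fun y hy => y.2) ⟨⟨0, by omega⟩, by simp; omega⟩
    intro a b c d
    omega
  by_cases h7 : n = 7
  · subst h7
    obtain rfl : t = 5 := by omega
    refine exists_sylow_of_involution ht hodd (by omega)
      (L := fun a b => a = 0 ∧ b = 1 ∨ a = 2 ∧ b = 3 ∨ a = 5 ∧ b = 6) ?_ (by simp) (by simp)
      (f := swap 0 5 * swap 1 6) ?_ ?_ ?_ ?_
    · intro a b c d
      omega
    all_goals decide
  · refine exists_sylow_of_involution ht hodd htn.le
      (L := fun a b => a = 0 ∧ b = 1 ∨ a = 2 ∧ b = 3 ∨ a + 1 = n ∧ b + 2 = n ∨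
        a + 3 = n ∧ b + 4 = n) ?_ (by simp) (by simp) (f := Fin.revPerm) ?_ ?_ ?_ ?_
    · intro a b c d
      omega
    · ext x
      simp [sq]
    · intro a b
      simp only [Fin.revPerm_apply, Fin.val_rev]
      omega
    · intro y hy
      simp only [Fin.revPerm_apply, Fin.val_rev]
      omega
    · refine ⟨⟨t - 1, by omega⟩, ?_, ?_⟩
      · simp only
        omega
      · simp only [Fin.revPerm_apply, Fin.val_rev]
        omega

theorem exists_sylow_five_three :
    ∃ (P : Sylow 2 (alternatingGroup (Fin 5))) (T : Sylow 3 (alternatingGroup (Fin 5))),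
      (P : Subgroup (alternatingGroup (Fin 5))) ⊔ (T : Subgroup _) = ⊤ := by
  refine exists_sylow_of_swapGroup_of_blockGroup le_rfl (L := fun _ _ => False)
    (f := Fin.revPerm) (fun _ _ _ _ h => h.elim) (by decide) (fun _ _ h => h) ?_
  set H := swapGroup (fun _ _ => False) Fin.revPerm ⊓ alternatingGroup (Fin 5) ⊔
    blockGroup 5 3 ⊓ alternatingGroup (Fin 5)
  have hf : Fin.revPerm ∈ H := Subgroup.mem_sup_left (Subgroup.mem_inf.2 ⟨mem_swapGroup _ _,
    mem_alternatingGroup.2 (by decide)⟩)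
  have hfirst := threeCycleLinked_first_interval_three (by omega) (H := H)
    (Subgroup.mem_sup_right (intervalCycle_mem (by omega) (by decide) (dvd_zero 3)))
  intro x
  by_cases hx : (x : ℕ) < 3
  · exact hfirst x hx
  · have := ((hfirst 2 (by decide)).symm.trans (hfirst x.rev (by rw [Fin.val_rev]; omega))).map hf
    rw [Fin.revPerm_apply, Fin.revPerm_apply, Fin.rev_rev] at this
    exact (hfirst 2 (by decide)).trans this

theorem exists_sylow_of_two_mul_le {t : ℕ} [NeZero t] (ht : t = 3 ∨ t = 5 ∨ 7 ≤ t) (hodd : Odd t)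
    (htn : 2 * t ≤ n) :
    ∃ (P : Sylow 2 (alternatingGroup (Fin n))) (T : Sylow t (alternatingGroup (Fin n))),
      (P : Subgroup (alternatingGroup (Fin n))) ⊔ (T : Subgroup _) = ⊤ := by
  obtain ⟨e, hte, hen, hne⟩ : ∃ e, t ∣ e ∧ e ≤ n ∧ n < e + t :=
    ⟨t * (n / t), dvd_mul_right _ _, Nat.mul_div_le n t, Nat.lt_mul_div_succ n (NeZero.pos t)⟩
  have h2e : 2 * t ≤ e := by
    by_contra hlt
    have := add_le_of_dvd_of_lt hte (dvd_mul_left t 2) (not_le.1 hlt)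
    omega
  set L : ℕ → ℕ → Prop := fun a b => a = 0 ∧ b = 1 ∨ a = 2 ∧ b = 3 ∨
    (t ∣ b ∧ a + 1 = b ∧ b + t ≤ n) ∨ (a + b + 1 = 2 * e ∧ e ≤ b ∧ b < n) with hLdef
  have hinner : ∀ b, t ∣ b → 0 < b → b + t ≤ n →
      (b = t ∨ 2 * t ≤ b) ∧ b + t ≤ e := fun b hb hb0 hbn => by
    refine ⟨?_, add_le_of_dvd_of_lt hb hte (by omega)⟩
    obtain h | h := (Nat.le_of_dvd hb0 hb).eq_or_lt
    · exact Or.inl h.symm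
    · have := add_le_of_dvd_of_lt (dvd_refl t) hb h
      omega
  have hL : PairsDisjoint L := by
    have hcross : ∀ b d, t ∣ b → t ∣ d → b = d ∨ b + t ≤ d ∨ d + t ≤ b := fun b d hb hd => by
      obtain h | h | h := lt_trichotomy b d
      · exact Or.inr (Or.inl (add_le_of_dvd_of_lt hb hd h))
      · exact Or.inl h
      · exact Or.inr (Or.inr (add_le_of_dvd_of_lt hd hb h))
    intro a b c d hab hcd
    rcases hab with h | h | ⟨hb, h, h'⟩ | h <;> rcases hcd with k | k | ⟨hd, k, k'⟩ | k <;>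
    · try have := hinner b hb (by omega) h'
      try have := hinner d hd (by omega) k'
      try have := hcross b d hb hd
      omega
  refine exists_sylow_of_swapGroup_of_blockGroup (by omega) hL (f := 1) (one_pow 2)
    (fun a b h => h) ?_
  set H := swapGroup L 1 ⊓ alternatingGroup (Fin n) ⊔ blockGroup n t ⊓ alternatingGroup (Fin n)
  have hc : ∀ s (h : s + t ≤ n), t ∣ s → intervalCycle h ∈ H := fun s h hs =>
    Subgroup.mem_sup_right (intervalCycle_mem h hodd hs)
  have hmem : ∀ a b c d : Fin n, L a b → L c d → a ≠ b → c ≠ d → swap a b * swap c d ∈ H :=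
    fun a b c d hab hcd h1 h2 => Subgroup.mem_sup_left
      ⟨mul_mem (swap_mem_swapGroup 1 hab) (swap_mem_swapGroup 1 hcd),
        swap_mul_swap_mem_alternatingGroup h1 h2⟩
  have hfirst : ∀ x : Fin n, (x : ℕ) < t → ThreeCycleLinked H ⟨0, by omega⟩ x := by
    obtain rfl | ht := ht
    · exact threeCycleLinked_first_interval_three (by omega) (hc 0 (by omega) (dvd_zero _))
    · exact threeCycleLinked_first_interval ht (by omega) (hc 0 (by omega) (dvd_zero _))
        (hmem _ _ _ _ (by simp [hLdef]) (by simp [hLdef]) (by simp) (by simp))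
  have hstep : ∀ a b : Fin n, L a b → 2 ≤ (a : ℕ) → 2 ≤ (b : ℕ) → a ≠ b →
      ThreeCycleLinked H ⟨0, by omega⟩ a → ThreeCycleLinked H ⟨0, by omega⟩ b := by
    intro a b hab ha hb hne hlink
    refine threeCycleLinked_of_swap_mul_swap (z := ⟨1, by omega⟩) ?_ ?_
      (hmem ⟨0, by omega⟩ ⟨1, by omega⟩ a b (by simp [hLdef]) hab (by simp) hne)
      (hfirst _ (by simp; omega)) hlink <;>
    · simp only [ne_eq, Fin.ext_iff]
      omega
  have hblocks : ∀ j (x : Fin n), j * t + t ≤ n → (x : ℕ) < j * t + t →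
      ThreeCycleLinked H ⟨0, by omega⟩ x := by
    intro j
    induction j with
    | zero =>
      intro x _ hx
      exact hfirst x (by omega)
    | succ j ih =>
      intro x hj hx
      have hdvd : t ∣ (j + 1) * t := dvd_mul_left _ _
      rw [Nat.succ_mul] at *
      by_cases hxj : (x : ℕ) < j * t + t
      · exact ih x (by omega) hxj
      have hs : ThreeCycleLinked H ⟨0, by omega⟩ ⟨j * t + t, by omega⟩ := by
        refine hstep ⟨j * t + t - 1, by omega⟩ _ (Or.inr (Or.inr (Or.inl ⟨hdvd, ?_, hj⟩))) ?_ ?_ ?_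
          (ih _ (by omega) ?_)
        · simp only; omega
        · simp only; omega
        · simp only; omega
        · simp only [ne_eq, Fin.ext_iff]; omega
        · simp only; omega
      have := threeCycleLinked_interval_of_fixed (hc _ hj hdvd) (by simp only; omega) hs
        (x - (j * t + t)) (by omega)
      convert this using 1
      ext
      simp only
      omega
  have he : ∀ x : Fin n, (x : ℕ) < e → ThreeCycleLinked H ⟨0, by omega⟩ x := by
    intro x hx
    obtain ⟨j, rfl⟩ := hte
    obtain _ | j := j
    · omega
    · rw [mul_comm, Nat.succ_mul] at *
      exact hblocks j x hen hx
  intro x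
  by_cases hx : (x : ℕ) < e
  · exact he x hx
  · refine hstep ⟨2 * e - 1 - x, by omega⟩ x (Or.inr (Or.inr (Or.inr ⟨?_, by omega, x.2⟩))) ?_ ?_ ?_
      (he _ ?_)
    · simp only; omega
    · simp only; omega
    · omega
    · simp only [ne_eq, Fin.ext_iff]; omega
    · simp only; omega

theorem exists_sylow_two_two (hn : 5 ≤ n) :
    ∃ P T : Sylow 2 (alternatingGroup (Fin n)),
      (P : Subgroup (alternatingGroup (Fin n))) ⊔ (T : Subgroup _) = ⊤ := by
  have : Nontrivial (Fin n) := Fin.nontrivial_iff_two_le.2 (by omega)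
  set L : ℕ → ℕ → Prop := fun a b => a % 2 = 0 ∧ a + 1 = b with hL
  set M : ℕ → ℕ → Prop := fun a b => a = 0 ∧ b = 1 ∨ 3 ≤ a ∧ a % 2 = 1 ∧ a + 1 = b with hM
  set f : Perm (Fin n) := swap ⟨0, by omega⟩ ⟨2, by omega⟩ * swap ⟨1, by omega⟩ ⟨3, by omega⟩ with hf
  have hfval : ∀ x : Fin n, (f x : ℕ) = if (x : ℕ) < 2 then (x : ℕ) + 2 else
      if (x : ℕ) < 4 then (x : ℕ) - 2 else x := by
    rintro ⟨x, hx⟩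
    simp only [hf, Perm.mul_apply, swap_apply_def, Fin.mk.injEq]
    split_ifs <;> simp_all [Fin.ext_iff] <;> omega
  have hS : IsPGroup 2 (swapGroup L f) := by
    refine isPGroup_swapGroup ?_ ?_ ?_
    · intro a b c d
      simp only [hL]
      omega
    · ext x
      rw [sq, Perm.mul_apply, hfval, hfval]
      split_ifs <;> simp <;> omega
    · intro a b
      simp only [hL]
      rw [hfval, hfval]
      split_ifs <;> omega
  have hR : IsPGroup 2 (swapGroup M (1 : Perm (Fin n))) := by
    refine isPGroup_swapGroup ?_ (one_pow 2) fun a b h => h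
    intro a b c d
    simp only [hM]
    omega
  refine exists_sylow_sup_eq_top hS hR ?_
  set H := swapGroup L f ⊓ alternatingGroup (Fin n) ⊔ swapGroup M 1 ⊓ alternatingGroup (Fin n)
  have hmemL : ∀ b (hb : b + 1 < n), b % 2 = 0 → 2 ≤ b → swap (⟨0, by omega⟩ : Fin n)
      ⟨1, by omega⟩ * swap ⟨b, by omega⟩ ⟨b + 1, hb⟩ ∈ H := fun b hb hb2 _ =>
    Subgroup.mem_sup_left ⟨mul_mem (swap_mem_swapGroup f (by simp [hL]))
      (swap_mem_swapGroup f (by simpa [hL])), swap_mul_swap_mem_alternatingGroup (by simp) (by simp)⟩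
  have hmemM : ∀ b (hb : b + 1 < n), b % 2 = 1 → 2 ≤ b → swap (⟨0, by omega⟩ : Fin n)
      ⟨1, by omega⟩ * swap ⟨b, by omega⟩ ⟨b + 1, hb⟩ ∈ H := fun b hb hb2 _ =>
    Subgroup.mem_sup_right ⟨mul_mem (swap_mem_swapGroup 1 (by simp [hM]))
      (swap_mem_swapGroup 1 (by simp [hM]; omega)),
        swap_mul_swap_mem_alternatingGroup (by simp) (by simp)⟩
  have hmem : ∀ b (hb : b + 1 < n), 2 ≤ b → swap (⟨0, by omega⟩ : Fin n)
      ⟨1, by omega⟩ * swap ⟨b, by omega⟩ ⟨b + 1, hb⟩ ∈ H := fun b hb h2 =>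
    (Nat.mod_two_eq_zero_or_one b).elim (hmemL b hb · h2) (hmemM b hb · h2)
  have hfmem : f ∈ H := Subgroup.mem_sup_left ⟨mem_swapGroup L f,
    swap_mul_swap_mem_alternatingGroup (by simp) (by simp)⟩
  have hw := hmem 3 (by omega) (by omega)
  rw [(swap_commute (by simp)).eq] at hw
  have e2 : (swap ⟨0, by omega⟩ ⟨1, by omega⟩ * swap ⟨2, by omega⟩ ⟨3, by omega⟩ : Perm (Fin n))
      ⟨3, by omega⟩ = ⟨2, by omega⟩ := by
    simp [swap_apply_def]
  have e4 : (swap ⟨0, by omega⟩ ⟨1, by omega⟩ * swap ⟨2, by omega⟩ ⟨3, by omega⟩ : Perm (Fin n))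
      ⟨4, by omega⟩ = ⟨4, by omega⟩ := by
    simp [swap_apply_def]
  have hcomm : Commute (swap ⟨0, by omega⟩ ⟨1, by omega⟩ * swap ⟨2, by omega⟩ ⟨3, by omega⟩)
      (swap (⟨0, by omega⟩ : Fin n) ⟨1, by omega⟩) :=
    Commute.mul_left rfl (swap_commute (by simp))
  have lt4 : 4 < n := hn
  have lt3 : 3 < n := by omega
  have lt2 : 2 < n := by omega
  obtain ⟨h23, h34⟩ := threeCycleLinked_of_commutator (x₂ := (⟨2, lt2⟩ : Fin n)) (x₃ := ⟨3, lt3⟩)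
    (x₄ := ⟨4, lt4⟩) (by simp) (by simp) (by simp) e2 e4 hcomm (hmem 2 (by omega) le_rfl) hw
  have hup : ∀ k (hk : k < n), 4 ≤ k → ThreeCycleLinked H ⟨3, by omega⟩ ⟨k, hk⟩ := by
    intro k hk h4
    induction k, h4 using Nat.le_induction with
    | base => exact h34
    | succ k h4 ih =>
      have := (ih (by omega)).map (hmem k hk (by omega))
      have h3 : (swap ⟨0, by omega⟩ ⟨1, by omega⟩ * swap ⟨k, by omega⟩ ⟨k + 1, hk⟩ : Perm (Fin n))
          ⟨3, lt3⟩ = ⟨3, lt3⟩ := by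
        rw [Perm.mul_apply, swap_apply_of_ne_of_ne (b := (⟨k + 1, hk⟩ : Fin n)),
          swap_apply_of_ne_of_ne] <;>
        · rw [ne_eq, Fin.mk.injEq]
          omega
      have hk' : (swap ⟨0, by omega⟩ ⟨1, by omega⟩ * swap ⟨k, by omega⟩ ⟨k + 1, hk⟩ : Perm (Fin n))
          ⟨k, by omega⟩ = ⟨k + 1, hk⟩ := by
        rw [Perm.mul_apply, swap_apply_left, swap_apply_of_ne_of_ne] <;>
        · simp only [ne_eq, Fin.mk.injEq]
          omega
      rwa [h3, hk'] at this
  have h24 := (h23.trans h34).symm.map hfmem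
  have h43 := h34.symm.map hfmem
  have f4 : f ⟨4, by omega⟩ = ⟨4, by omega⟩ := Fin.ext (by rw [hfval]; simp)
  have f3 : f ⟨3, by omega⟩ = ⟨1, by omega⟩ := Fin.ext (by rw [hfval]; simp)
  have f2 : f ⟨2, by omega⟩ = ⟨0, by omega⟩ := Fin.ext (by rw [hfval]; simp)
  rw [f4, f2] at h24
  rw [f4, f3] at h43
  have hall : ∀ x, ThreeCycleLinked H ⟨3, by omega⟩ x := by
    rintro ⟨x, hx⟩
    obtain rfl | rfl | rfl | rfl | h4 : x = 0 ∨ x = 1 ∨ x = 2 ∨ x = 3 ∨ 4 ≤ x := by omega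
    · exact h34.trans h24
    · exact h34.trans h43
    · exact h23.symm
    · exact ThreeCycleLinked.refl _
    · exact hup x hx h4
  exact fun a b => (hall a).symm.trans (hall b)

end Construction

theorem alternating_generated_by_sylow_two_and_sylow_t
    (n : ℕ) (hn : 5 ≤ n) (t : ℕ) (ht : t.Prime) (htn : t ≤ n) :
    ∃ (P : Sylow 2 ↥(alternatingGroup (Fin n)))
      (T : Sylow t ↥(alternatingGroup (Fin n))),
      (P : Subgroup ↥(alternatingGroup (Fin n))) ⊔ (T : Subgroup _) = ⊤ := by
  obtain rfl | hodd := ht.eq_two_or_odd'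
  · exact exists_sylow_two_two hn
  have : NeZero t := ⟨ht.ne_zero⟩
  have ht' : t = 3 ∨ t = 5 ∨ 7 ≤ t := by
    have := ht.two_le
    obtain ⟨k, rfl⟩ := hodd
    omega
  by_cases h2 : 2 * t ≤ n
  · exact exists_sylow_of_two_mul_le ht' hodd h2
  obtain rfl | ht' := ht'
  · obtain rfl : n = 5 := by omega
    exact exists_sylow_five_three
  · exact exists_sylow_of_lt_two_mul ht' hodd htn (by omega)
end

section
/- Let F be a finite field of characteristic p, let n ≥ 2, and let S = SL_n(F) be the special linear group of degree n over F. Let P be a Sylow p-subgroup of S and let x ∈ S be an element not lying in the center of S. Then there exists g ∈ S such that S is generated by P together with the conjugate g⁻¹xg; that is, ⟨P, g⁻¹xg⟩ = S. -/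
namespace Matrix

lemma IsUpperTriangular.mul_apply_self {ι R : Type*} [Fintype ι] [LinearOrder ι]
    [NonUnitalNonAssocSemiring R] {A B : Matrix ι ι R}
    (hA : A.IsUpperTriangular) (hB : B.IsUpperTriangular) (i : ι) :
    (A * B) i i = A i i * B i i := by
  rw [mul_apply, Finset.sum_eq_single i _ (by simp)]
  intro k _ hk
  rcases hk.lt_or_gt with h | h
  · rw [hA h, zero_mul]
  · rw [hB h, mul_zero]

namespace SpecialLinearGroup

variable {ι F : Type*} [Fintype ι] [DecidableEq ι] [Field F]

/-- The pair `(a, b)` is a root pair of `H` if `H` contains all the transvections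
`1 + t • vecMulVec a b`. -/
def IsRootPair (H : Subgroup (SpecialLinearGroup ι F)) (a b : ι → F) : Prop :=
  ∀ (t : F) (g : SpecialLinearGroup ι F), (g : Matrix ι ι F) = 1 + t • vecMulVec a b → g ∈ H

lemma exists_coe_eq_one_add_vecMulVec {a b : ι → F} (h : b ⬝ᵥ a = 0) :
    ∃ g : SpecialLinearGroup ι F, (g : Matrix ι ι F) = 1 + vecMulVec a b ∧
      ((g⁻¹ : SpecialLinearGroup ι F) : Matrix ι ι F) = 1 - vecMulVec a b := by
  have hdet (b : ι → F) (h : b ⬝ᵥ a = 0) : (1 + vecMulVec a b).det = 1 := by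
    rw [vecMulVec_eq Unit, det_one_add_replicateCol_mul_replicateRow, h, add_zero]
  let g : SpecialLinearGroup ι F := ⟨_, hdet b h⟩
  let g' : SpecialLinearGroup ι F := ⟨_, hdet (-b) (by simp [h])⟩
  have h_inv : g⁻¹ = g' := inv_eq_of_mul_eq_one_right <| Subtype.ext <| by
    change (1 + vecMulVec a b) * (1 + vecMulVec a (-b)) = 1
    simp [mul_add, add_mul, vecMulVec_mul_vecMulVec, h, vecMulVec_neg]
  exact ⟨g, rfl, by rw [h_inv]; simp [g', vecMulVec_neg, sub_eq_add_neg]⟩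

namespace IsRootPair

variable {H : Subgroup (SpecialLinearGroup ι F)} {a b c d : ι → F}

lemma conj (hab : IsRootPair H a b) {h : SpecialLinearGroup ι F} (hh : h ∈ H) :
    IsRootPair H ((h : Matrix ι ι F) *ᵥ a)
      (b ᵥ* ((h⁻¹ : SpecialLinearGroup ι F) : Matrix ι ι F)) := by
  intro t g hg
  have hmul : (h : Matrix ι ι F) * ((h⁻¹ : SpecialLinearGroup ι F) : Matrix ι ι F) = 1 := by
    rw [← coe_mul, mul_inv_cancel, coe_one]
  have hmul' : ((h⁻¹ : SpecialLinearGroup ι F) : Matrix ι ι F) * (h : Matrix ι ι F) = 1 := by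
    rw [← coe_mul, inv_mul_cancel, coe_one]
  have key : h⁻¹ * g * h ∈ H := by
    refine hab t _ ?_
    rw [coe_mul, coe_mul, hg, mul_add, add_mul, mul_one, hmul', ← vecMulVec_mul, ← mul_vecMulVec,
      mul_smul_comm, smul_mul_assoc, ← mul_assoc, ← mul_assoc, hmul', mul_assoc, hmul', one_mul,
      mul_one]
  have := H.mul_mem (H.mul_mem hh key) (H.inv_mem hh)
  simpa [mul_assoc] using this

lemma smul_smul (hab : IsRootPair H a b) (r s : F) : IsRootPair H (r • a) (s • b) := by
  intro t g hg
  refine hab (t * r * s) g ?_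
  rw [hg, smul_vecMulVec, vecMulVec_smul, _root_.smul_smul, _root_.smul_smul, mul_assoc]

lemma add_right (hab : IsRootPair H a b) (hac : IsRootPair H a c) (hb : b ⬝ᵥ a = 0)
    (hc : c ⬝ᵥ a = 0) : IsRootPair H a (b + c) := by
  intro t g hg
  obtain ⟨u, hu, -⟩ := exists_coe_eq_one_add_vecMulVec (a := a) (b := t • b) (by simp [hb])
  obtain ⟨v, hv, -⟩ := exists_coe_eq_one_add_vecMulVec (a := a) (b := t • c) (by simp [hc])
  have : g = u * v := by
    refine Subtype.ext ?_
    rw [hg, coe_mul, hu, hv]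
    simp [mul_add, add_mul, vecMulVec_mul_vecMulVec, hb, vecMulVec_add, vecMulVec_smul,
      add_assoc]
  rw [this]
  exact H.mul_mem (hab t u (by rw [hu, vecMulVec_smul])) (hac t v (by rw [hv, vecMulVec_smul]))

/-- Conjugating a root pair by the transvection `1 + vecMulVec c d`. -/
lemma act (hab : IsRootPair H a b) (hcd : IsRootPair H c d) (h : d ⬝ᵥ c = 0) :
    IsRootPair H (a + (d ⬝ᵥ a) • c) (b - (b ⬝ᵥ c) • d) := by
  obtain ⟨g, hg, hg'⟩ := exists_coe_eq_one_add_vecMulVec h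
  have := hab.conj (hcd 1 g (by rw [hg, one_smul]))
  rw [hg, hg'] at this
  simpa [add_mulVec, vecMul_sub, vecMulVec_mulVec, vecMul_vecMulVec] using this

lemma trans_single {i j k : ι} (hik : IsRootPair H (Pi.single i 1) (Pi.single k 1))
    (hkj : IsRootPair H (Pi.single k 1) (Pi.single j 1)) (h₁ : i ≠ k) (h₂ : k ≠ j) (h₃ : i ≠ j) :
    IsRootPair H (Pi.single i 1) (Pi.single j 1) := by
  have h := hik.act hkj (by simp [h₂])
  simp [h₃] at h
  have := hik.add_right (by simpa using h.smul_smul 1 (-1)) (by simp [h₁]) (by simp [h₁, h₃])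
  simpa using this

end IsRootPair

lemma diag2n_eq_prod_transvection {i j : ι} (hij : i ≠ j) {a : F} (ha : a ≠ 0) :
    diag2n hij a ha = transvection hij a * transvection hij.symm (-a⁻¹) * transvection hij a *
      transvection hij (-1) * transvection hij.symm 1 * transvection hij (-1) := by
  refine Subtype.ext ?_
  simp only [coe_mul, mul_assoc, diag2n_coe]
  change _ = Matrix.transvection i j a * (Matrix.transvection j i (-a⁻¹) *
    (Matrix.transvection i j a * (Matrix.transvection i j (-1) * (Matrix.transvection j i 1 *
      Matrix.transvection i j (-1)))))
  have hT (r s : ι) (c : F) (M : Matrix ι ι F) (k m : ι) :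
      (Matrix.transvection r s c * M) k m = if k = r then M k m + c * M s m else M k m := by
    split_ifs with h
    · subst h; simp
    · simp [h]
  have hT_one (r s : ι) (c : F) (k m : ι) : Matrix.transvection r s c k m =
      if k = r then (1 : Matrix ι ι F) k m + c * (1 : Matrix ι ι F) s m
      else (1 : Matrix ι ι F) k m :=
    mul_one (Matrix.transvection r s c) ▸ hT r s c 1 k m
  ext k m
  simp only [hT, hT_one, hij, hij.symm, if_true, if_false, diagonal_apply, one_apply]
  by_cases hki : k = i
  · subst hki
    simp [hij]
    split_ifs <;> simp_all
  by_cases hkj : k = j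
  · subst hkj
    simp [hij.symm]
    split_ifs <;> simp_all
  simp [hki, hkj]

lemma eq_top_of_transvection_mem [Nontrivial ι] {H : Subgroup (SpecialLinearGroup ι F)}
    (h : ∀ (i j : ι) (hij : i ≠ j) (c : F), transvection hij c ∈ H) : H = ⊤ := by
  refine (Subgroup.eq_top_iff' H).2 fun g ↦
    diagonal_transvection_induction' (· ∈ H) g (fun i j hij c hc ↦ ?_) h fun _ _ ↦ H.mul_mem
  rw [diag2n_eq_prod_transvection]
  exact H.mul_mem (H.mul_mem (H.mul_mem (H.mul_mem (H.mul_mem (h ..) (h ..)) (h ..)) (h ..))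
    (h ..)) (h ..)

section LinearOrder

variable [LinearOrder ι]

variable (ι F) in
/-- The upper unitriangular matrices. -/
def unitriangular : Subgroup (SpecialLinearGroup ι F) where
  carrier := {g | (g : Matrix ι ι F).IsUpperTriangular ∧ ∀ i, g i i = 1}
  one_mem' := ⟨by simpa using blockTriangular_one, by simp⟩
  mul_mem' := by
    rintro g h ⟨hg, hg'⟩ ⟨hh, hh'⟩
    refine ⟨by simpa using hg.mul hh, fun i ↦ ?_⟩
    rw [coe_mul, hg.mul_apply_self hh, hg', hh', one_mul]
  inv_mem' := by
    rintro g ⟨hg, hg'⟩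
    have h_mul : (g : Matrix ι ι F) * ((g⁻¹ : SpecialLinearGroup ι F) : Matrix ι ι F) = 1 := by
      rw [← coe_mul, mul_inv_cancel, coe_one]
    let _ := invertibleOfRightInverse _ _ h_mul
    have h_tri : ((g⁻¹ : SpecialLinearGroup ι F) : Matrix ι ι F).IsUpperTriangular := by
      rw [← inv_eq_right_inv h_mul]
      exact blockTriangular_inv_of_blockTriangular hg
    refine ⟨h_tri, fun i ↦ ?_⟩
    have := hg.mul_apply_self h_tri i
    rwa [h_mul, hg', one_apply_eq, one_mul, eq_comm] at this

lemma isPGroup_unitriangular (p : ℕ) [Fact p.Prime] [CharP F p] :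
    IsPGroup p (unitriangular ι F) := by
  rintro ⟨g, hg, hg'⟩
  refine ⟨Fintype.card ι, Subtype.ext (Subtype.ext ?_)⟩
  cases isEmpty_or_nonempty ι
  · exact Subsingleton.elim _ _
  have h_nil : ((g : Matrix ι ι F) - 1) ^ Fintype.card ι = 0 := by
    have := aeval_self_charpoly (g : Matrix ι ι F)
    rw [charpoly_of_isUpperTriangular _ hg] at this
    simpa [hg'] using this
  have h_pow : ((g : Matrix ι ι F) - 1) ^ p ^ Fintype.card ι = 0 :=
    pow_eq_zero_of_le (Nat.lt_pow_self (Fact.out : p.Prime).one_lt).le h_nil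
  have := add_pow_char_pow_of_commute p (Fintype.card ι)
    (Commute.one_right ((g : Matrix ι ι F) - 1))
  simpa [h_pow] using this

lemma isRootPair_of_unitriangular_le {H : Subgroup (SpecialLinearGroup ι F)}
    (hU : unitriangular ι F ≤ H) {a b : ι → F} (h : ∀ r s, s ≤ r → a r * b s = 0) :
    IsRootPair H a b := by
  refine fun t g hg ↦ hU ⟨fun r s (hrs : s < r) ↦ ?_, fun i ↦ ?_⟩
  · simp [hg, vecMulVec_apply, h r s hrs.le, hrs.ne']
  · simp [hg, vecMulVec_apply, h i i le_rfl]

/-- A subgroup containing the unitriangular matrices and the transvections in the lowest root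
subgroup is everything. -/
lemma eq_top_of_isRootPair_single {H : Subgroup (SpecialLinearGroup ι F)}
    (hU : unitriangular ι F ≤ H) {i₀ l : ι} (h₀ : ∀ i, i₀ ≤ i) (hl : ∀ i, i ≤ l) (hne : i₀ ≠ l)
    (h : IsRootPair H (Pi.single l 1) (Pi.single i₀ 1)) : H = ⊤ := by
  have : Nontrivial ι := ⟨i₀, l, hne⟩
  have h_lt {i j : ι} (hij : i < j) : IsRootPair H (Pi.single i 1) (Pi.single j 1) :=
    isRootPair_of_unitriangular_le hU fun r s hrs ↦ by
      simp only [Pi.single_apply]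
      grind
  have h_first {i : ι} (hi : i ≠ i₀) : IsRootPair H (Pi.single i 1) (Pi.single i₀ 1) := by
    rcases (hl i).eq_or_lt with rfl | hil
    · exact h
    · exact (h_lt hil).trans_single h hil.ne hne.symm hi
  have h_all {i j : ι} (hij : i ≠ j) : IsRootPair H (Pi.single i 1) (Pi.single j 1) := by
    rcases hij.lt_or_gt with hlt | hlt
    · exact h_lt hlt
    have hi : i ≠ i₀ := ((h₀ j).trans_lt hlt).ne'
    rcases (h₀ j).eq_or_lt with rfl | hj
    · exact h_first hij
    · exact (h_first hi).trans_single (h_lt hj) hi hj.ne hij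
  refine eq_top_of_transvection_mem fun i j hij c ↦ h_all hij c _ ?_
  rw [transvection_coe, ← single_eq_single_vecMulVec_single]
  simp

lemma eq_top_of_apply_ne_zero {H : Subgroup (SpecialLinearGroup ι F)}
    (hU : unitriangular ι F ≤ H) {i₀ l : ι} (h₀ : ∀ i, i₀ ≤ i) (hl : ∀ i, i ≤ l) (hne : i₀ ≠ l)
    {y : SpecialLinearGroup ι F} (hy : y ∈ H) (hy₁ : y l i₀ ≠ 0) (hy₂ : y⁻¹ l i₀ ≠ 0) :
    H = ⊤ := by
  have h_lt : i₀ < l := (h₀ l).lt_of_ne hne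
  have h_pair : IsRootPair H (Pi.single i₀ 1) (Pi.single l 1) :=
    isRootPair_of_unitriangular_le hU fun r s hrs ↦ by
      simp only [Pi.single_apply]
      grind
  replace h_pair := h_pair.conj hy
  set v := (y : Matrix ι ι F) *ᵥ Pi.single i₀ 1 with hv
  set φ := Pi.single l 1 ᵥ* ((y⁻¹ : SpecialLinearGroup ι F) : Matrix ι ι F) with hφ
  have hφv : φ ⬝ᵥ v = 0 := by
    rw [hφ, hv, dotProduct_mulVec, vecMul_vecMul, ← coe_mul, inv_mul_cancel, coe_one, vecMul_one]
    simp [hne]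
  have hvl : v l ≠ 0 := by simpa [hv] using hy₁
  have hφi : φ i₀ ≠ 0 := by simpa [hφ] using hy₂
  have hφ_dot : φ ⬝ᵥ (-(v l)⁻¹ • (v - v l • Pi.single l 1)) = φ l := by
    simp [dotProduct_sub, hφv, hvl]
  have h_act := (h_pair.act (c := -(v l)⁻¹ • (v - v l • Pi.single l 1)) (d := Pi.single l 1)
    (isRootPair_of_unitriangular_le hU fun r s hrs ↦ by
      by_cases hs : s = l
      · obtain rfl : r = l := le_antisymm (hl r) (hs ▸ hrs)
        simp
      · simp [hs]) (by simp)).smul_smul (v l)⁻¹ (φ i₀)⁻¹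
  set ψ := (φ i₀)⁻¹ • (φ - φ l • Pi.single l 1) with hψ
  have h_left : (v l)⁻¹ • (v + (Pi.single l 1 ⬝ᵥ v) • (-(v l)⁻¹ • (v - v l • Pi.single l 1))) =
      Pi.single l 1 := by
    ext k
    simp
    field_simp
    ring
  rw [h_left, hφ_dot, ← hψ] at h_act
  have hψi : ψ i₀ = 1 := by simp [hψ, hne, hφi]
  have hψl : ψ l = 0 := by simp [hψ]
  have h_last := h_act.act (c := Pi.single i₀ 1) (d := ψ - Pi.single i₀ 1)
    (isRootPair_of_unitriangular_le hU fun r s hrs ↦ by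
      by_cases hr : r = i₀
      · obtain rfl : s = i₀ := le_antisymm (hr ▸ hrs) (h₀ s)
        simp [hψi]
      · simp [hr]) (by simp [hψi])
  refine eq_top_of_isRootPair_single hU h₀ hl hne ?_
  simpa [hψi, hψl, hne] using h_last

end LinearOrder

open _root_.Module in
/-- The special linear group acts transitively on pairs consisting of a nonzero vector and a
nonzero linear form vanishing on it, the form being taken up to scalars. -/
lemma exists_mulVec_single_eq {v : ι → F} {f : Dual F (ι → F)} (hfv : f v = 0) (hf : f ≠ 0)
    (hv : v ≠ 0) {i₀ l : ι} (hne : i₀ ≠ l) :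
    ∃ g : SpecialLinearGroup ι F, ∃ c : F, c ≠ 0 ∧ (g : Matrix ι ι F) *ᵥ Pi.single i₀ 1 = v ∧
      ∀ w, f ((g : Matrix ι ι F) *ᵥ w) = c * w l := by
  obtain ⟨s, b, i, j, hij, rfl, rfl⟩ := exists_basis_of_pairing_eq_zero hfv hf hv
  obtain ⟨e, rfl, rfl⟩ : ∃ e : s ≃ ι, e i = i₀ ∧ e j = l := by
    let e₀ := b.indexEquiv (Pi.basisFun F ι)
    let e₁ := e₀.trans (Equiv.swap (e₀ i) i₀)
    have h₁ : e₁ i = i₀ := by simp [e₁]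
    refine ⟨e₁.trans (Equiv.swap (e₁ j) l), ?_, by simp⟩
    rw [Equiv.trans_apply, h₁]
    exact Equiv.swap_apply_of_ne_of_ne (h₁ ▸ e₁.injective.ne hij) hne
  set M := (Pi.basisFun F ι).toMatrix (b.reindex e) with hM
  have hdet : M.det ≠ 0 := ((Pi.basisFun F ι).isUnit_det (b.reindex e)).ne_zero
  have h_col (k : ι) : M.col k = b (e.symm k) := by
    ext r
    simp [hM, Basis.toMatrix_apply]
  refine ⟨⟨M.updateCol (e j) (M.det⁻¹ • M.col (e j)), ?_⟩, M.det⁻¹, inv_ne_zero hdet, ?_, ?_⟩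
  · rw [det_updateCol_smul]
    change _ * (M.updateCol (e j) fun r ↦ M r (e j)).det = 1
    rw [updateCol_eq_self, inv_mul_cancel₀ hdet]
  · ext r
    simpa [updateCol_apply, hij] using congrFun (h_col (e i)) r
  · suffices b.coord j ∘ₗ mulVecLin (M.updateCol (e j) (M.det⁻¹ • M.col (e j))) =
        M.det⁻¹ • LinearMap.proj (e j) from fun w ↦ by simpa using LinearMap.congr_fun this w
    refine (Pi.basisFun F ι).ext fun k ↦ ?_
    by_cases hk : k = e j
    · subst hk
      have : (M.updateCol (e j) (M.det⁻¹ • M.col (e j))).col (e j) = M.det⁻¹ • b j := by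
        rw [← e.symm_apply_apply j, ← h_col]
        ext; simp
      simp [this]
    · have : (M.updateCol (e j) (M.det⁻¹ • M.col (e j))).col k = b (e.symm k) := by
        rw [← h_col]
        ext; simp [hk]
      have hk' : e.symm k ≠ j := by rwa [Ne, Equiv.symm_apply_eq]
      simp [this, Ne.symm hk, hk']

open _root_.Module in
lemma exists_dual_apply_ne_zero {x : SpecialLinearGroup ι F}
    (hx : x ∉ Subgroup.center (SpecialLinearGroup ι F)) :
    ∃ (v : ι → F) (f : Dual F (ι → F)), v ≠ 0 ∧ f v = 0 ∧
      f ((x : Matrix ι ι F) *ᵥ v) ≠ 0 ∧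
      f (((x⁻¹ : SpecialLinearGroup ι F) : Matrix ι ι F) *ᵥ v) ≠ 0 := by
  obtain ⟨v, hv⟩ : ∃ v, LinearIndependent F ![v, (x : Matrix ι ι F) *ᵥ v] := by
    contrapose! hx
    obtain ⟨a, ha⟩ :=
      (mulVecLin (x : Matrix ι ι F)).exists_eq_smul_id_of_forall_notLinearIndependent hx
    have h_scalar : (x : Matrix ι ι F) = scalar ι a := by
      refine ext_of_mulVec_single fun i ↦ ?_
      ext j
      simpa [Pi.single_apply, diagonal_apply] using
        congrFun (LinearMap.congr_fun ha (Pi.single i 1)) j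
    exact mem_center_iff.2 ⟨a, by simpa [h_scalar] using x.2, h_scalar.symm⟩
  have hv₀ : v ≠ 0 := hv.ne_zero 0
  rw [LinearIndependent.pair_iff' hv₀] at hv
  have h₁ : (x : Matrix ι ι F) *ᵥ v ∉ Submodule.span F {v} := by
    simpa [Submodule.mem_span_singleton] using hv
  have h₂ : ((x⁻¹ : SpecialLinearGroup ι F) : Matrix ι ι F) *ᵥ v ∉ Submodule.span F {v} := by
    rw [Submodule.mem_span_singleton]
    rintro ⟨a, ha⟩
    have hxa : a • ((x : Matrix ι ι F) *ᵥ v) = v := by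
      rw [← mulVec_smul, ha, mulVec_mulVec, ← coe_mul, mul_inv_cancel, coe_one, one_mulVec]
    have ha₀ : a ≠ 0 := by
      rintro rfl
      exact hv₀ (by rw [← hxa, zero_smul])
    exact hv a⁻¹ (by rw [← hxa, smul_smul, inv_mul_cancel₀ ha₀, one_smul, hxa])
  obtain ⟨f₁, hf₁, hv₁⟩ := Submodule.exists_dual_map_eq_bot_of_notMem h₁ inferInstance
  obtain ⟨f₂, hf₂, hv₂⟩ := Submodule.exists_dual_map_eq_bot_of_notMem h₂ inferInstance
  replace hv₁ : f₁ v = 0 := by simpa [Submodule.map_span] using hv₁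
  replace hv₂ : f₂ v = 0 := by simpa [Submodule.map_span] using hv₂
  by_cases h₁₂ : f₁ (((x⁻¹ : SpecialLinearGroup ι F) : Matrix ι ι F) *ᵥ v) = 0
  · by_cases h₂₁ : f₂ ((x : Matrix ι ι F) *ᵥ v) = 0
    · exact ⟨v, f₁ + f₂, hv₀, by simp [hv₁, hv₂], by simpa [h₂₁],
        by rwa [LinearMap.add_apply, h₁₂, zero_add]⟩
    · exact ⟨v, f₂, hv₀, hv₂, h₂₁, hf₂⟩
  · exact ⟨v, f₁, hv₀, hv₁, hf₁, h₁₂⟩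

lemma exists_unitriangular_sup_zpowers_conj_eq_top [LinearOrder ι] {i₀ l : ι} (h₀ : ∀ i, i₀ ≤ i)
    (hl : ∀ i, i ≤ l) (hne : i₀ ≠ l) {x : SpecialLinearGroup ι F}
    (hx : x ∉ Subgroup.center (SpecialLinearGroup ι F)) :
    ∃ g : SpecialLinearGroup ι F, unitriangular ι F ⊔ Subgroup.zpowers (g⁻¹ * x * g) = ⊤ := by
  obtain ⟨v, f, hv, hfv, h₁, h₂⟩ := exists_dual_apply_ne_zero hx
  obtain ⟨g, c, -, hgv, hgf⟩ := exists_mulVec_single_eq hfv (by rintro rfl; simp at h₁) hv hne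
  have h_entry (z : SpecialLinearGroup ι F) (hz : f ((z : Matrix ι ι F) *ᵥ v) ≠ 0) :
      (g⁻¹ * z * g) l i₀ ≠ 0 := by
    have h_mulVec : (z : Matrix ι ι F) *ᵥ v = (g : Matrix ι ι F) *ᵥ
        (((g⁻¹ * z * g : SpecialLinearGroup ι F) : Matrix ι ι F) *ᵥ Pi.single i₀ 1) := by
      rw [← hgv, mulVec_mulVec, mulVec_mulVec, ← coe_mul, ← coe_mul]
      group
    rw [h_mulVec, hgf] at hz
    simpa using right_ne_zero_of_mul hz
  refine ⟨g, eq_top_of_apply_ne_zero le_sup_left h₀ hl hne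
    (Subgroup.mem_sup_right (Subgroup.mem_zpowers _)) (h_entry x h₁) ?_⟩
  rw [show (g⁻¹ * x * g)⁻¹ = g⁻¹ * x⁻¹ * g by group]
  exact h_entry _ h₂

end SpecialLinearGroup

end Matrix

theorem special_linear_generated_by_sylow_p_and_conjugate
    (p : ℕ) [Fact p.Prime] (F : Type*) [Field F] [Fintype F] [CharP F p]
    (n : ℕ) (hn : 2 ≤ n)
    (P : Sylow p (Matrix.SpecialLinearGroup (Fin n) F))
    (x : Matrix.SpecialLinearGroup (Fin n) F)
    (hx : x ∉ Subgroup.center (Matrix.SpecialLinearGroup (Fin n) F)) :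
    ∃ g : Matrix.SpecialLinearGroup (Fin n) F,
      (P : Subgroup (Matrix.SpecialLinearGroup (Fin n) F)) ⊔
        Subgroup.zpowers (g⁻¹ * x * g) = ⊤ := by
  obtain ⟨m, rfl⟩ := Nat.exists_eq_add_of_le' hn
  obtain ⟨g, hg⟩ := Matrix.SpecialLinearGroup.exists_unitriangular_sup_zpowers_conj_eq_top
    (i₀ := 0) (l := Fin.last (m + 1)) Fin.zero_le Fin.le_last (Fin.last_pos).ne hx
  obtain ⟨Q, hQ⟩ := (Matrix.SpecialLinearGroup.isPGroup_unitriangular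
    (ι := Fin (m + 2)) (F := F) p).exists_le_sylow
  obtain ⟨k, rfl⟩ := MulAction.exists_smul_eq (Matrix.SpecialLinearGroup (Fin (m + 2)) F) Q P
  refine ⟨g * k⁻¹, ?_⟩
  have h_top := congrArg (Subgroup.map (MulAut.conj k).toMonoidHom)
    (top_le_iff.1 (hg.ge.trans (sup_le_sup_right hQ _)))
  rw [Subgroup.map_sup, MonoidHom.map_zpowers,
    Subgroup.map_top_of_surjective _ (MulAut.conj k).surjective] at h_top
  rw [← h_top]
  congr 2
  simp [mul_assoc]
end

section
/- Let F be a finite field of characteristic p, let n ≥ 2 with (n, |F|) ≠ (2, 2), and let S = Sp_{2n}(F) be the symplectic group of degree 2n over F. Let P be a Sylow p-subgroup of S and let x ∈ S be an element not lying in the center of S. Then there exists g ∈ S such that S is generated by P together with the conjugate g⁻¹xg; that is, ⟨P, g⁻¹xg⟩ = S. -/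
namespace AlternatingSpace

variable {F V : Type*} [Field F] [AddCommGroup V] [Module F V]

/-- The isometry group of a bilinear form, inside the general linear group. -/
def isometries (B : LinearMap.BilinForm F V) : Subgroup (V ≃ₗ[F] V) where
  carrier := {g | ∀ v w, B (g v) (g w) = B v w}
  mul_mem' {a b} ha hb v w := by
    rw [LinearEquiv.mul_apply, LinearEquiv.mul_apply, ha, hb]
  one_mem' _ _ := rfl
  inv_mem' {a} ha v w := by
    rw [← ha (a⁻¹ v), ← LinearEquiv.mul_apply, ← LinearEquiv.mul_apply, mul_inv_cancel]
    rfl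

theorem apply_sub_eq_zero_of_fixed {B : LinearMap.BilinForm F V} {g : V ≃ₗ[F] V}
    (hg : g ∈ isometries B) (v : V) {w : V} (hw : g w = w) : B (g v - v) w = 0 := by
  rw [map_sub, LinearMap.sub_apply, sub_eq_zero, ← hg v w, hw]

theorem inv_apply_eq_iff (g : V ≃ₗ[F] V) {v w : V} : g⁻¹ v = w ↔ v = g w :=
  g.symm_apply_eq

theorem apply_inv_self (g : V ≃ₗ[F] V) (v : V) : g (g⁻¹ v) = v := g.apply_symm_apply v

/-- The isometries acting trivially on each quotient of the chain `0 ≤ W ≤ Wᗮ ≤ V`. -/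
def unipotentRadical (B : LinearMap.BilinForm F V) (W : Submodule F V) :
    Subgroup (V ≃ₗ[F] V) where
  carrier := {g | g ∈ isometries B ∧ (∀ w ∈ W, g w = w) ∧
    ∀ v, (∀ w ∈ W, B w v = 0) → g v - v ∈ W}
  mul_mem' {a b} ha hb := by
    refine ⟨mul_mem ha.1 hb.1, fun w hw => ?_, fun v hv => ?_⟩
    · rw [LinearEquiv.mul_apply, hb.2.1 w hw, ha.2.1 w hw]
    · have h := hb.2.2 v hv
      have e : (a * b) v - v = (b v - v) + (a v - v) := by
        rw [← ha.2.1 _ h, map_sub, LinearEquiv.mul_apply]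
        abel
      rw [e]
      exact add_mem h (ha.2.2 v hv)
  one_mem' := ⟨one_mem _, fun _ _ => rfl, fun v _ => by simp⟩
  inv_mem' {a} ha := by
    have h1 : ∀ w ∈ W, a⁻¹ w = w := fun w hw => by rw [inv_apply_eq_iff, ha.2.1 w hw]
    refine ⟨inv_mem ha.1, h1, fun v hv => ?_⟩
    have h := ha.2.2 v hv
    have e : a⁻¹ v - v = -(a v - v) := by
      rw [← h1 _ h, map_sub, inv_apply_eq_iff a |>.2 rfl]
      abel
    rw [e]
    exact neg_mem h

theorem unipotentRadical_le_isometries (B : LinearMap.BilinForm F V) (W : Submodule F V) :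
    unipotentRadical B W ≤ isometries B := fun _ h => h.1

theorem isPGroup_unipotentRadical (p : ℕ) [Fact p.Prime] [CharP F p] [Nontrivial V]
    (B : LinearMap.BilinForm F V) (W : Submodule F V) :
    IsPGroup p (unipotentRadical B W) := by
  rintro ⟨g, hg, hW, hWp⟩
  refine ⟨2, Subtype.ext <| LinearEquiv.toLinearMap_injective ?_⟩
  have : CharP (Module.End F V) p :=
    charP_of_injective_algebraMap (algebraMap F (Module.End F V)).injective p
  set f : Module.End F V := g.toLinearMap with hf
  have h3 : (f - 1) ^ 3 = 0 := by
    ext v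
    have h1 : g v - v ∈ {u | ∀ w ∈ W, B w u = 0} := fun w hw => by
      rw [map_sub, sub_eq_zero, ← hg w v, hW w hw]
    have h2 := hW _ (hWp _ h1)
    simp only [pow_succ, pow_zero, one_mul, Module.End.mul_apply, LinearMap.sub_apply,
      Module.End.one_apply, LinearMap.zero_apply, hf, LinearEquiv.coe_coe]
    rw [h2, sub_self]
  have h4 : (f - 1) ^ p ^ 2 = 0 := by
    refine pow_eq_zero_of_le ?_ h3
    have := (Fact.out : p.Prime).two_le
    nlinarith
  rw [sub_pow_char_pow_of_commute _ _ (Commute.one_right f), one_pow, sub_eq_zero] at h4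
  have h5 : ((g ^ p ^ 2 : V ≃ₗ[F] V) : V →ₗ[F] V) = f ^ p ^ 2 :=
    map_pow (LinearEquiv.automorphismGroup.toLinearMapMonoidHom) g _
  exact h5.trans h4

theorem exists_mem_and_apply_ne_zero {W : Submodule F V} {φ ψ : V →ₗ[F] F}
    (hφ : ∃ v ∈ W, φ v ≠ 0) (hψ : ∃ v ∈ W, ψ v ≠ 0) :
    ∃ v ∈ W, φ v ≠ 0 ∧ ψ v ≠ 0 := by
  obtain ⟨v, hv, hφv⟩ := hφ
  obtain ⟨w, hw, hψw⟩ := hψ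
  by_cases h1 : ψ v = 0
  · by_cases h2 : φ w = 0
    · exact ⟨v + w, add_mem hv hw, by simpa [h2] using hφv, by simpa [h1] using hψw⟩
    · exact ⟨w, hw, h2, hψw⟩
  · exact ⟨v, hv, hφv, h1⟩

section Separating

variable {B : LinearMap.BilinForm F V} (hB : ∀ v, (∀ w, B v w = 0) → v = 0)
include hB

theorem exists_apply_ne_zero {v : V} (hv : v ≠ 0) : ∃ w, B v w ≠ 0 := by
  contrapose! hv
  exact hB v hv

theorem exists_apply_eq_zero_and_ne_zero {e f : V} (hf : f ∉ F ∙ e) :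
    ∃ v ∈ LinearMap.ker (B e), B f v ≠ 0 := by
  contrapose! hf
  by_cases he : e = 0
  · have : f = 0 := hB f fun w => hf w (by simp [he])
    simp [this]
  · obtain ⟨z, hz⟩ := exists_apply_ne_zero hB he
    refine Submodule.mem_span_singleton.2 ⟨B f z / B e z, ?_⟩
    rw [← sub_eq_zero]
    refine hB _ fun v => ?_
    have h := hf (v - (B e v / B e z) • z) (by simp [hz])
    simp only [map_sub, map_smul, smul_eq_mul] at h
    simp only [map_sub, map_smul, LinearMap.sub_apply, LinearMap.smul_apply, smul_eq_mul]
    linear_combination -h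

theorem exists_isometry [FiniteDimensional F V] (f : V →ₗ[F] V)
    (hf : ∀ v w, B (f v) (f w) = B v w) : ∃ g ∈ isometries B, ∀ v, g v = f v := by
  have hi : Function.Injective f := by
    rw [injective_iff_map_eq_zero]
    refine fun v hv => hB v fun w => ?_
    rw [← hf, hv, map_zero, LinearMap.zero_apply]
  exact ⟨LinearEquiv.ofInjectiveEndo f hi, fun v w => hf v w, fun v => rfl⟩

variable (hA : B.IsAlt)
include hA

theorem exists_siegel [FiniteDimensional F V] {h a : V} (c : F) (ha : B h a = 0) :
    ∃ g ∈ isometries B, ∀ v, g v = v + B h v • a + B a v • h + (c * B h v) • h := by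
  have hn := LinearMap.BilinForm.IsAlt.neg_eq hA
  have hs := LinearMap.BilinForm.IsAlt.self_eq_zero hA
  refine exists_isometry hB (LinearMap.id + (B h).smulRight a + (B a).smulRight h +
    (c • B h).smulRight h) fun v w => ?_
  have ha' : B a h = 0 := by rw [← hn, ha, neg_zero]
  simp only [LinearMap.add_apply, LinearMap.id_apply, LinearMap.smulRight_apply,
    LinearMap.smul_apply, map_add, map_smul, smul_eq_mul, hs, ha, ha', ← hn v h, ← hn v a]
  ring

theorem exists_transvection [FiniteDimensional F V] (u : V) (c : F) :
    ∃ g ∈ isometries B, ∀ v, g v = v + (c * B u v) • u := by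
  obtain ⟨g, hg, h⟩ := exists_siegel hB hA c (map_zero (B u))
  exact ⟨g, hg, fun v => by simp [h]⟩

theorem exists_mem_unipotentRadical [FiniteDimensional F V] {W : Submodule F V}
    (hW : ∀ v ∈ W, ∀ w ∈ W, B v w = 0) {h w d : V} (hh : h ∈ W) (hw : B h w ≠ 0)
    (hd : ∀ v ∈ W, B v d = 0) : ∃ g ∈ unipotentRadical B W, g w = w + d := by
  have hn := LinearMap.BilinForm.IsAlt.neg_eq hA
  obtain ⟨g, hg, H⟩ := exists_siegel hB hA (-(B ((B h w)⁻¹ • d) w) / B h w)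
    (show B h ((B h w)⁻¹ • d) = 0 by simp [hd h hh])
  have hd' : ∀ v ∈ W, B d v = 0 := fun v hv => by rw [← hn, hd v hv, neg_zero]
  refine ⟨g, ⟨hg, fun v hv => ?_, fun v hv => ?_⟩, ?_⟩
  · simp [H, hW h hh v hv, hd' v hv]
  · rw [H, hv h hh]
    simpa using W.smul_mem ((B h w)⁻¹ * B d v) hh
  · rw [H]
    simp [smul_smul, hw]

omit hB in
theorem transvection_mem_unipotentRadical {W : Submodule F V}
    (hW : ∀ v ∈ W, ∀ w ∈ W, B v w = 0) {h : V} (hh : h ∈ W) {c : F} {g : V ≃ₗ[F] V}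
    (hg : ∀ v, g v = v + (c * B h v) • h) : g ∈ unipotentRadical B W := by
  have hn := LinearMap.BilinForm.IsAlt.neg_eq hA
  have hs := LinearMap.BilinForm.IsAlt.self_eq_zero hA
  refine ⟨fun v w => ?_, fun v hv => ?_, fun v hv => ?_⟩
  · simp only [hg, map_add, map_smul, LinearMap.add_apply, LinearMap.smul_apply, smul_eq_mul,
      hs, ← hn v h]
    ring
  · simp [hg, hW h hh v hv]
  · simp [hg, hv h hh]

end Separating

/-- The vectors all of whose transvections belong to `H`. -/
def transvectionCenters (B : LinearMap.BilinForm F V) (H : Subgroup (V ≃ₗ[F] V)) : Set V :=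
  {u | ∀ (g : V ≃ₗ[F] V) (c : F), (∀ v, g v = v + (c * B u v) • u) → g ∈ H}

section Centers

variable {B : LinearMap.BilinForm F V} {H : Subgroup (V ≃ₗ[F] V)}

theorem apply_mem_transvectionCenters {g : V ≃ₗ[F] V} (hg : g ∈ isometries B) (hgH : g ∈ H)
    {u : V} (hu : u ∈ transvectionCenters B H) : g u ∈ transvectionCenters B H := by
  intro t c ht
  have h : g⁻¹ * t * g ∈ H := hu _ c fun v => by
    rw [LinearEquiv.mul_apply, LinearEquiv.mul_apply, inv_apply_eq_iff, ht, hg, map_add, map_smul]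
  simpa [mul_assoc] using H.mul_mem (H.mul_mem hgH h) (H.inv_mem hgH)

theorem smul_mem_transvectionCenters (a : F) {u : V} (hu : u ∈ transvectionCenters B H) :
    a • u ∈ transvectionCenters B H := fun t c ht => hu t (c * a ^ 2) fun v => by
  rw [ht, map_smul, LinearMap.smul_apply, smul_smul, smul_eq_mul]
  congr 2
  ring

variable [FiniteDimensional F V] (hB : ∀ v, (∀ w, B v w = 0) → v = 0) (hA : B.IsAlt)
include hB hA

theorem add_mem_transvectionCenters {u v : V} (hu : u ∈ transvectionCenters B H)
    (hv : v ∈ transvectionCenters B H) (huv : B u v ≠ 0) :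
    u + v ∈ transvectionCenters B H := by
  obtain ⟨t, ht, h⟩ := exists_transvection hB hA u (B u v)⁻¹
  have := apply_mem_transvectionCenters ht (hu t _ h) hv
  rwa [h, inv_mul_cancel₀ huv, one_smul, add_comm] at this

theorem isometries_le_of_transvectionCenters_eq_univ
    (hH : ∀ u, u ∈ transvectionCenters B H) : isometries B ≤ H := by
  have hn := LinearMap.BilinForm.IsAlt.neg_eq hA
  have hs := LinearMap.BilinForm.IsAlt.self_eq_zero hA
  suffices key : ∀ (k : ℕ), ∀ g ∈ isometries B, Module.finrank F V ≤
      Module.finrank F (LinearMap.eqLocus (g : V →ₗ[F] V) LinearMap.id) + k → g ∈ H from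
    fun g hg => key _ g hg (Nat.le_add_left _ _)
  intro k
  induction k with
  | zero =>
    intro g _ h
    have htop := Submodule.eq_top_of_finrank_eq (le_antisymm (Submodule.finrank_le _) h)
    have : g = 1 := LinearEquiv.ext fun v => by
      have hv : v ∈ LinearMap.eqLocus (g : V →ₗ[F] V) LinearMap.id := htop ▸ Submodule.mem_top
      exact hv
    exact this ▸ H.one_mem
  | succ k ih =>
    have moving : ∀ g ∈ isometries B, (∃ v, B v (g v) ≠ 0) → Module.finrank F V ≤
        Module.finrank F (LinearMap.eqLocus (g : V →ₗ[F] V) LinearMap.id) + (k + 1) →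
        g ∈ H := by
      rintro g hg ⟨v, hv⟩ hk
      have hvv : B (g v - v) v ≠ 0 := by
        rw [map_sub, LinearMap.sub_apply, hs, sub_zero, ← hn]
        exact neg_ne_zero.2 hv
      obtain ⟨t, ht, h⟩ := exists_transvection hB hA (g v - v) (B (g v - v) v)⁻¹
      have htv : t v = g v := by rw [h, inv_mul_cancel₀ hvv, one_smul, add_sub_cancel]
      have htH := hH _ t _ h
      have hlt : LinearMap.eqLocus (g : V →ₗ[F] V) LinearMap.id <
          LinearMap.eqLocus ((t⁻¹ * g : V ≃ₗ[F] V) : V →ₗ[F] V) LinearMap.id := by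
        refine SetLike.lt_iff_le_and_exists.2 ⟨fun w hw => ?_, v, ?_, fun hv' => hv ?_⟩
        · have hw : g w = w := hw
          change t⁻¹ (g w) = w
          rw [hw, inv_apply_eq_iff, h, apply_sub_eq_zero_of_fixed hg v hw, mul_zero, zero_smul,
            add_zero]
        · change t⁻¹ (g v) = v
          rw [inv_apply_eq_iff, htv]
        · rw [show g v = v from hv', hs]
      have := ih (t⁻¹ * g) (mul_mem (inv_mem ht) hg)
        (by have := Submodule.finrank_lt_finrank_of_lt hlt; omega)
      simpa using H.mul_mem htH this
    intro g hg hk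
    by_cases hmv : ∃ v, B v (g v) ≠ 0
    · exact moving g hg hmv hk
    push Not at hmv
    by_cases h1 : g = 1
    · exact h1 ▸ H.one_mem
    obtain ⟨w, hw⟩ : ∃ w, g w ≠ w := by
      contrapose! h1
      exact LinearEquiv.ext h1
    have hu : g w - w ≠ 0 := sub_ne_zero.2 hw
    obtain ⟨t, ht, h⟩ := exists_transvection hB hA (g w - w) 1
    obtain ⟨y, hy⟩ := exists_apply_ne_zero hB hu
    obtain ⟨z, -, hz, hgz⟩ := exists_mem_and_apply_ne_zero (W := ⊤) (φ := B (g w - w))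
      (ψ := B (g w - w) ∘ₗ (g : V →ₗ[F] V)) ⟨y, trivial, hy⟩
      ⟨g⁻¹ y, trivial, by simpa [apply_inv_self] using hy⟩
    have htg : t * g ∈ H := by
      refine moving _ (mul_mem ht hg) ⟨z, ?_⟩ (hk.trans ?_)
      · rw [LinearEquiv.mul_apply, h, map_add, hmv, zero_add, map_smul, smul_eq_mul, one_mul,
          ← hn _ z]
        exact mul_ne_zero hgz (neg_ne_zero.2 hz)
      · refine Nat.add_le_add_right (Submodule.finrank_mono fun v hv => ?_) _
        have hv : g v = v := hv
        change t (g v) = v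
        rw [hv, h, apply_sub_eq_zero_of_fixed hg w hv, mul_zero, zero_smul, add_zero]
    simpa using H.mul_mem (H.inv_mem (hH _ t _ h)) htg

theorem mem_transvectionCenters_of_unipotentRadical_le {W : Submodule F V}
    (hW : ∀ v ∈ W, ∀ w ∈ W, B v w = 0) (hWH : unipotentRadical B W ≤ H) {h u w : V}
    (hh : h ∈ W) (hu : u ∈ transvectionCenters B H) (hhu : B h u ≠ 0) (hhw : B h w ≠ 0)
    (hd : ∀ v ∈ W, B v w * B h u = B h w * B v u) : w ∈ transvectionCenters B H := by
  have hu' := smul_mem_transvectionCenters (B h w / B h u) hu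
  obtain ⟨g, hg, hgw⟩ := exists_mem_unipotentRadical hB hA hW hh
    (w := (B h w / B h u) • u) (d := w - (B h w / B h u) • u) (by simp [hhu, hhw])
    fun v hv => by
      rw [map_sub, map_smul, smul_eq_mul, sub_eq_zero]
      field_simp
      rw [hd v hv]
  have := apply_mem_transvectionCenters hg.1 (hWH hg) hu'
  rwa [hgw, add_sub_cancel] at this

theorem isometries_le_of_apply_ne_zero {x : V ≃ₗ[F] V} (hx : x ∈ isometries B) (hxH : x ∈ H)
    {e : V} (he : B e (x e) ≠ 0) (hWH : unipotentRadical B (F ∙ e) ≤ H) :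
    isometries B ≤ H := by
  have hn := LinearMap.BilinForm.IsAlt.neg_eq hA
  have hs := LinearMap.BilinForm.IsAlt.self_eq_zero hA
  have hW : ∀ v ∈ F ∙ e, ∀ w ∈ F ∙ e, B v w = 0 := by
    simp only [Submodule.mem_span_singleton]
    rintro _ ⟨a, rfl⟩ _ ⟨b, rfl⟩
    simp [hs]
  have heW := Submodule.mem_span_singleton_self (R := F) e
  have hec : e ∈ transvectionCenters B H :=
    fun g c hg => hWH (transvection_mem_unipotentRadical hA hW heW hg)
  have hout : ∀ w, B e w ≠ 0 → w ∈ transvectionCenters B H := fun w hw =>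
    mem_transvectionCenters_of_unipotentRadical_le hB hA hW hWH heW
      (apply_mem_transvectionCenters hx hxH hec) he hw fun v hv => by
        obtain ⟨a, rfl⟩ := Submodule.mem_span_singleton.1 hv
        simp only [map_smul, LinearMap.smul_apply, smul_eq_mul]
        ring
  refine isometries_le_of_transvectionCenters_eq_univ hB hA fun w => ?_
  by_cases hw : B e w = 0
  · by_cases hw0 : w = 0
    · rw [hw0, ← zero_smul F e]
      exact smul_mem_transvectionCenters 0 hec
    obtain ⟨y, hy⟩ := exists_apply_ne_zero hB hw0
    obtain ⟨v, -, hev, hwv⟩ := exists_mem_and_apply_ne_zero (W := ⊤) (φ := B e) (ψ := B w)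
      ⟨x e, trivial, he⟩ ⟨y, trivial, hy⟩
    have := add_mem_transvectionCenters hB hA (hout (w - v) (by simpa [hw] using hev))
      (hout v hev) (by simpa [hs] using hwv)
    rwa [sub_add_cancel] at this
  · exact hout w hw

theorem isometries_le_of_apply_eq_zero {x : V ≃ₗ[F] V} (hx : x ∈ isometries B) (hxH : x ∈ H)
    {e f : V} (hxe : B e (x e) = 0) (hef : B e f = 0) (hf : B f (x e) ≠ 0)
    (hWH : unipotentRadical B (Submodule.span F {e, f}) ≤ H) : isometries B ≤ H := by
  have hn := LinearMap.BilinForm.IsAlt.neg_eq hA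
  have hs := LinearMap.BilinForm.IsAlt.self_eq_zero hA
  have hfe : B f e = 0 := by rw [← hn, hef, neg_zero]
  have hW : ∀ v ∈ Submodule.span F {e, f}, ∀ w ∈ Submodule.span F {e, f}, B v w = 0 := by
    simp only [Submodule.mem_span_pair]
    rintro _ ⟨a, b, rfl⟩ _ ⟨c, d, rfl⟩
    simp [hs, hef, hfe]
  have heW : e ∈ Submodule.span F {e, f} := Submodule.subset_span (by simp)
  have hfW : f ∈ Submodule.span F {e, f} := Submodule.subset_span (by simp)
  have hec : e ∈ transvectionCenters B H :=
    fun g c hg => hWH (transvection_mem_unipotentRadical hA hW heW hg)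
  have hxec := apply_mem_transvectionCenters hx hxH hec
  have hfspan : f ∉ F ∙ e := fun h => by
    obtain ⟨a, rfl⟩ := Submodule.mem_span_singleton.1 h
    simp [hxe] at hf
  have hxspan : x e ∉ F ∙ e := fun h => by
    obtain ⟨a, ha⟩ := Submodule.mem_span_singleton.1 h
    simp [← ha, hfe] at hf
  have hcell : ∀ w, B e w = 0 → B f w ≠ 0 → w ∈ transvectionCenters B H := fun w hew hfw =>
    mem_transvectionCenters_of_unipotentRadical_le hB hA hW hWH hfW hxec hf hfw fun v hv => by
      obtain ⟨a, b, rfl⟩ := Submodule.mem_span_pair.1 hv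
      simp only [map_add, map_smul, LinearMap.add_apply, LinearMap.smul_apply, smul_eq_mul,
        hew, hxe]
      ring
  have hperp : ∀ w, B e w = 0 → w ∈ transvectionCenters B H := by
    intro w hew
    by_cases hfw : B f w = 0
    · by_cases hw : w ∈ F ∙ e
      · obtain ⟨a, rfl⟩ := Submodule.mem_span_singleton.1 hw
        exact smul_mem_transvectionCenters a hec
      obtain ⟨v, hev, hfv, hwv⟩ := exists_mem_and_apply_ne_zero
        (exists_apply_eq_zero_and_ne_zero hB hfspan) (exists_apply_eq_zero_and_ne_zero hB hw)
      rw [LinearMap.mem_ker] at hev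
      have := add_mem_transvectionCenters hB hA
        (hcell (w - v) (by simp [hew, hev]) (by simpa [hfw] using hfv))
        (hcell v hev hfv) (by simpa [hs] using hwv)
      rwa [sub_add_cancel] at this
    · exact hcell w hew hfw
  have hxperp : ∀ w, B (x e) w = 0 → w ∈ transvectionCenters B H := by
    intro w hw
    have := apply_mem_transvectionCenters hx hxH
      (hperp (x⁻¹ w) (by rwa [← hx, apply_inv_self]))
    rwa [apply_inv_self] at this
  refine isometries_le_of_transvectionCenters_eq_univ hB hA fun w => ?_
  by_cases hew : B e w = 0
  · exact hperp w hew
  by_cases hxw : B (x e) w = 0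
  · exact hxperp w hxw
  have hw : w ∉ F ∙ e := fun h => by
    obtain ⟨a, rfl⟩ := Submodule.mem_span_singleton.1 h
    simp [hs] at hew
  obtain ⟨v, hev, hxv, hwv⟩ := exists_mem_and_apply_ne_zero
    (exists_apply_eq_zero_and_ne_zero hB hxspan) (exists_apply_eq_zero_and_ne_zero hB hw)
  rw [LinearMap.mem_ker] at hev
  have h0 : B (x e) w / B (x e) v ≠ 0 := div_ne_zero hxw hxv
  have := add_mem_transvectionCenters hB hA
    (hxperp (w - (B (x e) w / B (x e) v) • v) (by simp [hxv]))
    (hperp ((B (x e) w / B (x e) v) • v) (by simp [hev])) (by simp [hs, hwv, hxw, hxv])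
  rwa [sub_add_cancel] at this

end Centers

theorem exists_isPGroup_isometries_le [FiniteDimensional F V] [Nontrivial V]
    {B : LinearMap.BilinForm F V} (hB : ∀ v, (∀ w, B v w = 0) → v = 0) (hA : B.IsAlt)
    (p : ℕ) [Fact p.Prime] [CharP F p] {x : V ≃ₗ[F] V} (hx : x ∈ isometries B)
    (hxs : ∀ a : F, ∃ v, x v ≠ a • v) :
    ∃ U ≤ isometries B, IsPGroup p U ∧ isometries B ≤ U ⊔ Subgroup.zpowers x := by
  have hxH (U : Subgroup (V ≃ₗ[F] V)) : x ∈ U ⊔ Subgroup.zpowers x :=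
    (le_sup_right : _ ≤ U ⊔ Subgroup.zpowers x) (Subgroup.mem_zpowers x)
  by_cases h : ∃ e, B e (x e) ≠ 0
  · obtain ⟨e, he⟩ := h
    exact ⟨_, unipotentRadical_le_isometries B (F ∙ e), isPGroup_unipotentRadical p B _,
      isometries_le_of_apply_ne_zero hB hA hx (hxH _) he le_sup_left⟩
  push Not at h
  obtain ⟨e, he⟩ : ∃ e, x e ∉ F ∙ e := by
    by_contra! hspan
    obtain ⟨a, ha⟩ := LinearMap.exists_eq_smul_id_of_forall_notLinearIndependent
      (f := (x : V →ₗ[F] V)) fun v hv => by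
        obtain ⟨b, hb⟩ := Submodule.mem_span_singleton.1 (hspan v)
        have := (LinearIndependent.pair_iff.1 hv) b (-1) (by simp [hb])
        simp at this
    obtain ⟨v, hv⟩ := hxs a
    exact hv (LinearMap.congr_fun ha v)
  obtain ⟨f, hef, hf⟩ := exists_apply_eq_zero_and_ne_zero hB he
  have hf' : B f (x e) ≠ 0 := by
    rw [← LinearMap.BilinForm.IsAlt.neg_eq hA]
    exact neg_ne_zero.2 hf
  exact ⟨_, unipotentRadical_le_isometries B (Submodule.span F {e, f}),
    isPGroup_unipotentRadical p B _,
    isometries_le_of_apply_eq_zero hB hA hx (hxH _) (h e) hef hf' le_sup_left⟩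

end AlternatingSpace

namespace SymplecticGroup

open Matrix AlternatingSpace

variable {l F : Type*} [Fintype l] [DecidableEq l] [Field F]

/-- The action of the symplectic group on column vectors. -/
noncomputable def toLinearEquiv : symplecticGroup l F →* ((l ⊕ l → F) ≃ₗ[F] (l ⊕ l → F)) :=
  (LinearMap.GeneralLinearGroup.generalLinearEquiv F (l ⊕ l → F)).toMonoidHom.comp
    (((toLinAlgEquiv' : Matrix (l ⊕ l) (l ⊕ l) F ≃ₐ[F] _) :
      Matrix (l ⊕ l) (l ⊕ l) F →* Module.End F (l ⊕ l → F)).comp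
        (symplecticGroup l F).subtype).toHomUnits

theorem toLinearEquiv_apply (A : symplecticGroup l F) (v : l ⊕ l → F) :
    toLinearEquiv A v = (A : Matrix (l ⊕ l) (l ⊕ l) F) *ᵥ v := rfl

theorem toLinearEquiv_injective : Function.Injective (toLinearEquiv (l := l) (F := F)) :=
  fun _ _ h => Subtype.ext <| toLin'.injective <| LinearMap.ext fun v => LinearEquiv.congr_fun h v

theorem toBilin'_J_mulVec (A : Matrix (l ⊕ l) (l ⊕ l) F) (v w : l ⊕ l → F) :
    toBilin' (J l F) (A *ᵥ v) (A *ᵥ w) = toBilin' (Aᵀ * J l F * A) v w := by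
  simp [toBilin'_apply', dotProduct_mulVec, ← mulVec_mulVec, ← mulVec_transpose]

theorem range_toLinearEquiv :
    (toLinearEquiv (l := l) (F := F)).range = isometries (toBilin' (J l F)) := by
  ext g
  constructor
  · rintro ⟨A, rfl⟩ v w
    rw [toLinearEquiv_apply, toLinearEquiv_apply, toBilin'_J_mulVec, mem_iff'.1 A.2]
  · intro hg
    have hv : ∀ v, LinearMap.toMatrix' (g : (l ⊕ l → F) →ₗ[F] _) *ᵥ v = g v := fun v => by
      rw [LinearMap.toMatrix'_mulVec]
      rfl
    have hmem : LinearMap.toMatrix' (g : (l ⊕ l → F) →ₗ[F] _) ∈ symplecticGroup l F := by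
      refine mem_iff'.2 (toBilin'.injective (LinearMap.ext₂ fun v w => ?_))
      rw [← toBilin'_J_mulVec, hv, hv, hg]
    exact ⟨⟨_, hmem⟩, LinearEquiv.ext fun v => hv v⟩

theorem isAlt_toBilin'_J : (toBilin' (J l F)).IsAlt := fun v => by
  simp [toBilin'_apply', J, fromBlocks_mulVec, dotProduct, neg_mulVec, mul_comm]

theorem toBilin'_J_separating (v : l ⊕ l → F) (h : ∀ w, toBilin' (J l F) v w = 0) : v = 0 :=
  (LinearMap.BilinForm.nondegenerate_toBilin'_of_det_ne_zero' _ (isUnit_det_J l F).ne_zero).1 v h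

theorem mem_center_of_eq_smul {x : symplecticGroup l F} {a : F}
    (h : ∀ v, toLinearEquiv x v = a • v) : x ∈ Subgroup.center (symplecticGroup l F) := by
  refine Subgroup.mem_center_iff.2 fun g =>
    toLinearEquiv_injective (LinearEquiv.ext fun v => ?_)
  rw [map_mul, map_mul, LinearEquiv.mul_apply, LinearEquiv.mul_apply, h, h, map_smul]

theorem exists_isPGroup_sup_zpowers_eq_top [Nonempty l] (p : ℕ) [Fact p.Prime] [CharP F p]
    {x : symplecticGroup l F} (hx : x ∉ Subgroup.center (symplecticGroup l F)) :
    ∃ U : Subgroup (symplecticGroup l F), IsPGroup p U ∧ U ⊔ Subgroup.zpowers x = ⊤ := by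
  have hxs : ∀ a : F, ∃ v, toLinearEquiv x v ≠ a • v := by
    by_contra! h
    obtain ⟨a, ha⟩ := h
    exact hx (mem_center_of_eq_smul ha)
  obtain ⟨U, hU, hUp, hle⟩ := exists_isPGroup_isometries_le toBilin'_J_separating
    isAlt_toBilin'_J p (range_toLinearEquiv.le ⟨x, rfl⟩) hxs
  rw [← range_toLinearEquiv] at hU hle
  refine ⟨U.comap toLinearEquiv, hUp.comap_of_injective _ toLinearEquiv_injective, ?_⟩
  rw [eq_top_iff, ← Subgroup.map_le_map_iff_of_injective toLinearEquiv_injective,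
    Subgroup.map_sup, Subgroup.map_comap_eq_self hU, MonoidHom.map_zpowers,
    ← MonoidHom.range_eq_map]
  exact hle

end SymplecticGroup

theorem symplectic_generated_by_sylow_p_and_conjugate
    (p : ℕ) [Fact p.Prime] (F : Type*) [Field F] [Fintype F] [CharP F p]
    (n : ℕ) (hn : 2 ≤ n) (hnF : ¬ (n = 2 ∧ Fintype.card F = 2))
    (P : Sylow p ↥(Matrix.symplecticGroup (Fin n) F))
    (x : ↥(Matrix.symplecticGroup (Fin n) F))
    (hx : x ∉ Subgroup.center ↥(Matrix.symplecticGroup (Fin n) F)) :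
    ∃ g : ↥(Matrix.symplecticGroup (Fin n) F),
      (P : Subgroup ↥(Matrix.symplecticGroup (Fin n) F)) ⊔
        Subgroup.zpowers (g⁻¹ * x * g) = ⊤ := by
  have : Nonempty (Fin n) := ⟨⟨0, by omega⟩⟩
  obtain ⟨U, hU, hUx⟩ := SymplecticGroup.exists_isPGroup_sup_zpowers_eq_top p hx
  obtain ⟨Q, hUQ⟩ := hU.exists_le_sylow
  obtain ⟨g, rfl⟩ := MulAction.exists_smul_eq (Matrix.symplecticGroup (Fin n) F) Q P
  refine ⟨g⁻¹, ?_⟩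
  have hQ : (Q : Subgroup _) ⊔ Subgroup.zpowers x = ⊤ :=
    top_le_iff.1 (hUx.ge.trans (sup_le_sup_right hUQ _))
  have hmap := congrArg (Subgroup.map (MulAut.conj g).toMonoidHom) hQ
  rw [Subgroup.map_sup, MonoidHom.map_zpowers, Subgroup.map_top_of_surjective _
    (MulAut.conj g).surjective] at hmap
  rw [inv_inv]
  exact hmap
end
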